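/- arXiv:2310.05903 — 2 statements merged into one kernel-verified Lean document; each statement's English description precedes it below -/
import Mathlib

section
/- Let G be a graph with no even hole, no star cutset, and no sector wheel. Let P = p1-…-pk be a flat path of G, and let W1, W2 be vertex sets with W1 ∩ W2 = V(P), W1 ∪ W2 ⊆ N[P], G[W1] and G[W2] chordal, and N(p1) ∩ N(pk) ⊆ W1 ∪ W2. Then there exist W1' ⊇ W1 and W2' ⊇ W2 such that W1' ∩ W2' = V(P), W1' ∪ W2' = N[P], and G[W1'] and G[W2'] are chordal. -/
open Classical

universe u

/-- `IsHoleOn G n H`: `H` is the vertex set of an induced cycle of `G` of length `n ≥ 4`. -/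
def IsHoleOn {V : Type u} (G : SimpleGraph V) (n : ℕ) (H : Set V) : Prop :=
  4 ≤ n ∧ ∃ f : ZMod n → V, Function.Injective f ∧ Set.range f = H ∧
    ∀ i j : ZMod n, G.Adj (f i) (f j) ↔ (j = i + 1 ∨ i = j + 1)

/-- A hole: an induced cycle of length at least 4. -/
def IsHole {V : Type u} (G : SimpleGraph V) (H : Set V) : Prop :=
  ∃ n : ℕ, IsHoleOn G n H

/-- No induced cycle of even length. -/
def EvenHoleFree {V : Type u} (G : SimpleGraph V) : Prop :=
  ∀ (n : ℕ) (H : Set V), IsHoleOn G n H → ¬ Even n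

/-- `G[X]` is chordal: no hole of `G` is contained in `X`. -/
def ChordalSet {V : Type u} (G : SimpleGraph V) (X : Set V) : Prop :=
  ∀ H : Set V, H ⊆ X → ¬ IsHole G H

/-- A wheel `(H, w)`: a hole `H` and `w ∉ H` with at least 3 neighbors in `H`. -/
def IsWheel {V : Type u} (G : SimpleGraph V) (H : Set V) (w : V) : Prop :=
  IsHole G H ∧ w ∉ H ∧ 3 ≤ (H ∩ {u | G.Adj w u}).ncard

/-- An induced path of `G`, recorded as the list of its vertices in order. -/
def IsInducedPathList {V : Type u} (G : SimpleGraph V) (l : List V) : Prop :=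
  l ≠ [] ∧ l.Nodup ∧
    ∀ (i j : ℕ) (hi : i < l.length) (hj : j < l.length),
      G.Adj (l.get ⟨i, hi⟩) (l.get ⟨j, hj⟩) ↔ (i + 1 = j ∨ j + 1 = i)

/-- A vertex set that induces a path. -/
def InducesPath {V : Type u} (G : SimpleGraph V) (S : Set V) : Prop :=
  ∃ l : List V, IsInducedPathList G l ∧ {v | v ∈ l} = S

/-- A sector wheel: a wheel `(H, w)` where `w` is complete to `H` or
`N(w) ∩ H` induces a path. -/
def IsSectorWheel {V : Type u} (G : SimpleGraph V) (H : Set V) (w : V) : Prop :=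
  IsWheel G H w ∧
    ((∀ u ∈ H, G.Adj w u) ∨ InducesPath G (H ∩ {u | G.Adj w u}))

/-- A twin wheel: a wheel `(H, w)` where `N(w) ∩ H` induces a three-vertex path. -/
def IsTwinWheel {V : Type u} (G : SimpleGraph V) (H : Set V) (w : V) : Prop :=
  IsWheel G H w ∧ ∃ a b c : V, a ≠ b ∧ b ≠ c ∧ a ≠ c ∧
    H ∩ {u | G.Adj w u} = {a, b, c} ∧ G.Adj a b ∧ G.Adj b c ∧ ¬ G.Adj a c

/-- A short pyramid: a wheel `(H, w)` where `N(w) ∩ H` is an edge plus an isolated vertex. -/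
def IsShortPyramid {V : Type u} (G : SimpleGraph V) (H : Set V) (w : V) : Prop :=
  IsWheel G H w ∧ ∃ a b c : V, a ≠ b ∧ b ≠ c ∧ a ≠ c ∧
    H ∩ {u | G.Adj w u} = {a, b, c} ∧ G.Adj a b ∧ ¬ G.Adj a c ∧ ¬ G.Adj b c

/-- A flat path: an induced path all of whose interior vertices have degree 2 in `G`. -/
def IsFlatPath {V : Type u} (G : SimpleGraph V) (l : List V) : Prop :=
  IsInducedPathList G l ∧
    ∀ (i : ℕ) (hi : i < l.length), 0 < i → i + 1 < l.length →
      ({u | G.Adj (l.get ⟨i, hi⟩) u}).ncard = 2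

/-- The closed neighborhood `N[S]` of a set of vertices. -/
def ClosedNbhd {V : Type u} (G : SimpleGraph V) (S : Set V) : Set V :=
  S ∪ {v | ∃ s ∈ S, G.Adj v s}

/-- `(W1, W2)` (a precover on a path with vertex set `S`) extends to a chordal cover of `G`. -/
def ExtendsToCover {V : Type u} (G : SimpleGraph V) (S W1 W2 : Set V) : Prop :=
  ∃ X1 X2 : Set V, W1 ⊆ X1 ∧ W2 ⊆ X2 ∧ ChordalSet G X1 ∧ ChordalSet G X2 ∧
    X1 ∩ X2 = S ∧ X1 ∪ X2 = Set.univ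

/-- Flat path extendable. -/
def FPE {V : Type u} (G : SimpleGraph V) : Prop :=
  ∀ l : List V, IsFlatPath G l →
    ∀ W1 W2 : Set V, ChordalSet G W1 → ChordalSet G W2 →
      W1 ∩ W2 = {v | v ∈ l} → W1 ∪ W2 = ClosedNbhd G {v | v ∈ l} →
      ExtendsToCover G {v | v ∈ l} W1 W2

/-- Weakly flat path extendable: only paths with at most two vertices are considered. -/
def WeaklyFPE {V : Type u} (G : SimpleGraph V) : Prop :=
  ∀ l : List V, IsInducedPathList G l → l.length ≤ 2 →
    ∀ W1 W2 : Set V, ChordalSet G W1 → ChordalSet G W2 →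
      W1 ∩ W2 = {v | v ∈ l} → W1 ∪ W2 = ClosedNbhd G {v | v ∈ l} →
      ExtendsToCover G {v | v ∈ l} W1 W2

/-- Minimal non flat path extendable. -/
def MNFPE {V : Type u} (G : SimpleGraph V) : Prop :=
  ¬ FPE G ∧ ∀ S : Set V, S ≠ Set.univ → FPE (G.induce S)

/-- Minimal non-weakly flat path extendable. -/
def MinNonWeaklyFPE {V : Type u} (G : SimpleGraph V) : Prop :=
  ¬ WeaklyFPE G ∧ ∀ S : Set V, S ≠ Set.univ → WeaklyFPE (G.induce S)

/-- A witness path `l` with witness sets `W1, W2`: a precover on a flat path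
admitting no extension to a chordal cover. -/
def WitnessPath {V : Type u} (G : SimpleGraph V) (l : List V) (W1 W2 : Set V) : Prop :=
  IsFlatPath G l ∧ ChordalSet G W1 ∧ ChordalSet G W2 ∧
    W1 ∩ W2 = {v | v ∈ l} ∧ W1 ∪ W2 = ClosedNbhd G {v | v ∈ l} ∧
    ¬ ExtendsToCover G {v | v ∈ l} W1 W2

/-- A witness path of length zero or one with witness sets, for the weak notion. -/
def WeakWitness {V : Type u} (G : SimpleGraph V) (l : List V) (W1 W2 : Set V) : Prop :=
  IsInducedPathList G l ∧ l.length ≤ 2 ∧ ChordalSet G W1 ∧ ChordalSet G W2 ∧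
    W1 ∩ W2 = {v | v ∈ l} ∧ W1 ∪ W2 = ClosedNbhd G {v | v ∈ l} ∧
    ¬ ExtendsToCover G {v | v ∈ l} W1 W2

/-- `N(v)` is the union of a clique and a singleton. -/
def NearlySimplicial {V : Type u} (G : SimpleGraph V) (v : V) : Prop :=
  ∃ (K : Set V) (u : V), G.IsClique K ∧ {w | G.Adj v w} = K ∪ {u}

/-- `G` has a star cutset. -/
def HasStarCutset {V : Type u} (G : SimpleGraph V) : Prop :=
  G.Connected ∧ ∃ (v : V) (C : Set V), v ∈ C ∧ C ⊆ insert v {u | G.Adj v u} ∧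
    ¬ (G.induce (Cᶜ : Set V)).Connected

/-- `v` is the center of a star cutset of `G`. -/
def IsStarCutsetCenter {V : Type u} (G : SimpleGraph V) (v : V) : Prop :=
  G.Connected ∧ ∃ C : Set V, v ∈ C ∧ C ⊆ insert v {u | G.Adj v u} ∧
    ¬ (G.induce (Cᶜ : Set V)).Connected

/-- `G` has a full star cutset, i.e. a star cutset of the form `N[v]`. -/
def HasFullStarCutset {V : Type u} (G : SimpleGraph V) : Prop :=
  G.Connected ∧ ∃ v : V,
    ¬ (G.induce (((insert v {u | G.Adj v u}) : Set V)ᶜ)).Connected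

/-- A clique cutset. -/
def IsCliqueCutset {V : Type u} (G : SimpleGraph V) (Q : Set V) : Prop :=
  G.IsClique Q ∧ ¬ (G.induce (Qᶜ : Set V)).Connected

/-- `C` is (the vertex set of) a connected component of `G[S]`. -/
def IsCompOf {V : Type u} (G : SimpleGraph V) (S C : Set V) : Prop :=
  ∃ comp : (G.induce S).ConnectedComponent, C = Subtype.val '' comp.supp

/-- A marker path for the side `(A, C, B)` of a 2-join, with ends `a ∈ A` and `b ∈ B`
and interior in `C`. -/
def IsMarkerPath {V : Type u} (G : SimpleGraph V) (A C B : Set V) (a b : V)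
    (l : List V) : Prop :=
  IsInducedPathList G l ∧ a ∈ A ∧ b ∈ B ∧
    ∃ m : List V, l = a :: (m ++ [b]) ∧ ∀ v ∈ m, v ∈ C

/-- A 2-join of `G`. -/
def IsTwoJoin {V : Type u} (G : SimpleGraph V) (A1 C1 B1 A2 C2 B2 : Set V) : Prop :=
  ([A1, C1, B1, A2, C2, B2] : List (Set V)).Pairwise Disjoint ∧
  A1 ∪ C1 ∪ B1 ∪ A2 ∪ C2 ∪ B2 = Set.univ ∧
  (∀ a ∈ A1, ∀ b ∈ A2, G.Adj a b) ∧
  (∀ a ∈ B1, ∀ b ∈ B2, G.Adj a b) ∧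
  (∀ u ∈ A1 ∪ C1 ∪ B1, ∀ v ∈ A2 ∪ C2 ∪ B2, G.Adj u v →
    ((u ∈ A1 ∧ v ∈ A2) ∨ (u ∈ B1 ∧ v ∈ B2))) ∧
  (∃ (a b : V) (l : List V), IsMarkerPath G A1 C1 B1 a b l ∧
      A1 ∪ C1 ∪ B1 ≠ {v | v ∈ l}) ∧
  (∃ (a b : V) (l : List V), IsMarkerPath G A2 C2 B2 a b l ∧
      A2 ∪ C2 ∪ B2 ≠ {v | v ∈ l})

/-- A leaf of a graph: a vertex of degree one. -/
def IsLeaf {V : Type u} (T : SimpleGraph V) (v : V) : Prop :=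
  ({u | T.Adj v u}).ncard = 1

/-- The graph `B(T)` built from a tree `T` whose bipartition is given by the proper
2-coloring `c`: vertices are the edges of `T` plus two extra vertices `x_false, x_true`
(encoded as `Bool`); two edges are adjacent iff they share an endpoint, `x_i` is adjacent
to the pendant edge at each leaf on side `i`, and `x_false` is adjacent to `x_true`. -/
def BGraph {V : Type u} (T : SimpleGraph V) (c : V → Bool) :
    SimpleGraph (↥T.edgeSet ⊕ Bool) :=
  SimpleGraph.fromRel fun a b =>
    match a, b with
    | Sum.inl e, Sum.inl f => ∃ v : V, v ∈ e.val ∧ v ∈ f.val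
    | Sum.inl e, Sum.inr i => ∃ v : V, IsLeaf T v ∧ c v = i ∧ v ∈ e.val
    | Sum.inr _, Sum.inl _ => False
    | Sum.inr _, Sum.inr _ => True

/-- `g 0, …, g (n - 1)` are the vertices of a hole, in cyclic order. -/
structure IsHoleSeq {V : Type u} (G : SimpleGraph V) (n : ℕ) (g : ℕ → V) : Prop where
  four_le : 4 ≤ n
  ne : ∀ i j, i < j → j < n → g i ≠ g j
  adj_iff : ∀ i j, i < j → j < n → (G.Adj (g i) (g j) ↔ j = i + 1 ∨ (i = 0 ∧ j + 1 = n))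

theorem zmod_eq_add_one_iff_val {n : ℕ} [NeZero n] (hn : 4 ≤ n) (i j : ZMod n) :
    j = i + 1 ↔ (j.val = i.val + 1 ∨ (j.val = 0 ∧ i.val + 1 = n)) := by
  have : Fact (1 < n) := ⟨by omega⟩
  have hi := i.val_lt
  have hj := j.val_lt
  rw [← (ZMod.val_injective n).eq_iff, ZMod.val_add, ZMod.val_one]
  by_cases h : i.val + 1 = n
  · rw [h, Nat.mod_self]; omega
  · rw [Nat.mod_eq_of_lt (by omega)]; omega

theorem IsHoleSeq.isHoleOn {V : Type u} {G : SimpleGraph V} {n : ℕ} {g : ℕ → V}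
    (h : IsHoleSeq G n g) : IsHoleOn G n (g '' Set.Iio n) := by
  have hn := h.four_le
  have : NeZero n := ⟨by omega⟩
  refine ⟨hn, fun x => g x.val, ?_, ?_, ?_⟩
  · intro x y hxy
    apply ZMod.val_injective n
    rcases lt_trichotomy x.val y.val with hlt | heq | hlt
    · exact absurd hxy (h.ne _ _ hlt y.val_lt)
    · exact heq
    · exact absurd hxy.symm (h.ne _ _ hlt x.val_lt)
  · ext v
    constructor
    · rintro ⟨x, rfl⟩
      exact ⟨x.val, x.val_lt, rfl⟩
    · rintro ⟨i, hi, rfl⟩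
      exact ⟨(i : ZMod n), by simp only [ZMod.val_natCast_of_lt hi]⟩
  · intro x y
    have hx := x.val_lt
    have hy := y.val_lt
    rw [zmod_eq_add_one_iff_val hn, zmod_eq_add_one_iff_val hn]
    rcases lt_trichotomy x.val y.val with hlt | heq | hlt
    · rw [h.adj_iff _ _ hlt hy]; omega
    · obtain rfl := ZMod.val_injective n heq
      simp only [SimpleGraph.irrefl, false_iff]
      omega
    · rw [G.adj_comm, h.adj_iff _ _ hlt hx]; omega

theorem IsHoleSeq.isHole {V : Type u} {G : SimpleGraph V} {n : ℕ} {g : ℕ → V}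
    (h : IsHoleSeq G n g) : IsHole G (g '' Set.Iio n) := ⟨n, h.isHoleOn⟩

/-- Reading a hole in cyclic order from any starting point. -/
theorem IsHoleSeq.of_zmod {V : Type u} {G : SimpleGraph V} {n : ℕ} (hn : 4 ≤ n)
    {f : ZMod n → V} (hinj : Function.Injective f)
    (hadj : ∀ i j : ZMod n, G.Adj (f i) (f j) ↔ (j = i + 1 ∨ i = j + 1)) (x : ZMod n) :
    IsHoleSeq G n (fun j => f (x + j)) := by
  have : NeZero n := ⟨by omega⟩
  refine ⟨hn, ?_, ?_⟩
  · intro i j hij hj he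
    have := congrArg ZMod.val (add_left_cancel (hinj he))
    rw [ZMod.val_natCast_of_lt (by omega), ZMod.val_natCast_of_lt hj] at this
    omega
  · intro i j hij hj
    rw [hadj, add_assoc, add_assoc, add_right_inj, add_right_inj,
      zmod_eq_add_one_iff_val hn, zmod_eq_add_one_iff_val hn,
      ZMod.val_natCast_of_lt hj, ZMod.val_natCast_of_lt (hij.trans hj)]
    omega

theorem IsHole.exists_seq {V : Type u} {G : SimpleGraph V} {H : Set V} (hH : IsHole G H)
    {v : V} (hv : v ∈ H) :
    ∃ (n : ℕ) (g : ℕ → V), IsHoleSeq G n g ∧ g 0 = v ∧ g '' Set.Iio n = H := by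
  obtain ⟨n, hn, f, hinj, rfl, hadj⟩ := hH
  obtain ⟨x, rfl⟩ := hv
  have : NeZero n := ⟨by omega⟩
  refine ⟨n, _, IsHoleSeq.of_zmod hn hinj hadj x, by simp, ?_⟩
  ext v
  constructor
  · rintro ⟨i, -, rfl⟩
    exact ⟨_, rfl⟩
  · rintro ⟨y, rfl⟩
    exact ⟨(y - x).val, ZMod.val_lt _, by simp⟩

/-- A hole meeting `S` and its complement can be read so that it enters `S` at once. -/
theorem IsHole.exists_seq_enter {V : Type u} {G : SimpleGraph V} {H : Set V} (hH : IsHole G H)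
    {S : Set V} {a b : V} (ha : a ∈ H) (haS : a ∈ S) (hb : b ∈ H) (hbS : b ∉ S) :
    ∃ (n : ℕ) (g : ℕ → V), IsHoleSeq G n g ∧ g 0 ∉ S ∧ g 1 ∈ S ∧ g '' Set.Iio n = H := by
  obtain ⟨n, hn, f, hinj, rfl, hadj⟩ := hH
  obtain ⟨x, rfl⟩ := ha
  obtain ⟨y, rfl⟩ := hb
  have : NeZero n := ⟨by omega⟩
  have key : ∃ z, f z ∉ S ∧ f (z + 1) ∈ S := by
    by_contra! hcon
    have hall : ∀ t : ℕ, f (y + t) ∉ S := by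
      intro t
      induction t with
      | zero => simpa using hbS
      | succ t ih => simpa [add_assoc] using hcon _ ih
    have := hall (x - y).val
    simp [haS] at this
  obtain ⟨z, hz0, hz1⟩ := key
  refine ⟨n, _, IsHoleSeq.of_zmod hn hinj hadj z, by simpa using hz0, by simpa using hz1, ?_⟩
  ext v
  constructor
  · rintro ⟨i, -, rfl⟩
    exact ⟨_, rfl⟩
  · rintro ⟨w, rfl⟩
    exact ⟨(w - z).val, ZMod.val_lt _, by simp⟩

theorem IsHole.exists_two_nbrs {V : Type u} {G : SimpleGraph V} {H : Set V} (hH : IsHole G H)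
    {v : V} (hv : v ∈ H) :
    ∃ x ∈ H, ∃ y ∈ H, x ≠ y ∧ G.Adj v x ∧ G.Adj v y := by
  obtain ⟨n, g, hg, rfl, rfl⟩ := hH.exists_seq hv
  have hn := hg.four_le
  refine ⟨g 1, ⟨1, by simp; omega, rfl⟩, g (n - 1), ⟨n - 1, by simp; omega, rfl⟩,
    hg.ne _ _ (by omega) (by omega), ?_, ?_⟩
  · rw [hg.adj_iff _ _ (by omega) (by omega)]; omega
  · rw [hg.adj_iff _ _ (by omega) (by omega)]; omega

theorem IsHole.three_le_ncard {V : Type u} [Finite V] {G : SimpleGraph V} {H : Set V}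
    (hH : IsHole G H) : 3 ≤ H.ncard := by
  obtain ⟨n, hn, f, hinj, rfl, -⟩ := hH
  rw [Set.ncard_range_of_injective hinj, Nat.card_zmod]
  omega

theorem chordalSet_mono {V : Type u} {G : SimpleGraph V} {X Y : Set V} (hXY : X ⊆ Y)
    (hY : ChordalSet G Y) : ChordalSet G X := fun H hH => hY H (hH.trans hXY)

/-- Without sector wheels, the closed neighborhood of a vertex is chordal. -/
theorem chordalSet_closedNbhd_vertex {V : Type u} [Finite V] {G : SimpleGraph V}
    (hSW : ∀ (H : Set V) (w : V), ¬ IsSectorWheel G H w) (v : V) :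
    ChordalSet G {u | u = v ∨ G.Adj v u} := by
  intro H hsub hH
  by_cases hv : v ∈ H
  · obtain ⟨n, g, hg, rfl, rfl⟩ := hH.exists_seq hv
    have hn := hg.four_le
    rcases hsub ⟨2, by simp; omega, rfl⟩ with h | h
    · exact hg.ne 0 2 (by omega) (by omega) h.symm
    · rw [hg.adj_iff _ _ (by omega) (by omega)] at h
      omega
  · have hall : ∀ u ∈ H, G.Adj v u := fun u hu =>
      (hsub hu).resolve_left (fun h => hv (h ▸ hu))
    refine hSW H v ⟨⟨hH, hv, ?_⟩, Or.inl hall⟩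
    rw [show H ∩ {u | G.Adj v u} = H from Set.inter_eq_left.2 hall]
    exact hH.three_le_ncard

/-- A hole is not separated by a single vertex. -/
theorem IsHole.subset_or_subset_of_cut_vertex {V : Type u} {G : SimpleGraph V} {H L R : Set V}
    (hH : IsHole G H) {s : V} (hcov : H ⊆ L ∪ R) (hs : L ∩ R ⊆ {s})
    (hno : ∀ x ∈ H, ∀ y ∈ H, x ∈ L → x ∉ R → y ∈ R → y ∉ L → ¬ G.Adj x y) :
    H ⊆ L ∨ H ⊆ R := by
  have hseq : ∃ (n : ℕ) (g : ℕ → V), IsHoleSeq G n g ∧ g '' Set.Iio n = H ∧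
      ∀ i, 0 < i → i < n → g i ≠ s := by
    by_cases hsH : s ∈ H
    · obtain ⟨n, g, hg, hg0, rfl⟩ := hH.exists_seq hsH
      exact ⟨n, g, hg, rfl, fun i h0 hi he => hg.ne 0 i h0 hi (hg0.trans he.symm)⟩
    · obtain ⟨v, hv⟩ : H.Nonempty := by
        obtain ⟨n, -, f, -, rfl, -⟩ := hH
        exact Set.range_nonempty f
      obtain ⟨n, g, hg, -, rfl⟩ := hH.exists_seq hv
      exact ⟨n, g, hg, rfl, fun i _ hi he => hsH ⟨i, hi, he⟩⟩
  obtain ⟨n, g, hg, rfl, hgs⟩ := hseq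
  have hn := hg.four_le
  have mem : ∀ i, i < n → g i ∈ g '' Set.Iio n := fun i hi => ⟨i, hi, rfl⟩
  have aux : ∀ L R : Set V, g '' Set.Iio n ⊆ L ∪ R → L ∩ R ⊆ {s} →
      (∀ x ∈ g '' Set.Iio n, ∀ y ∈ g '' Set.Iio n, x ∈ L → x ∉ R → y ∈ R → y ∉ L →
        ¬ G.Adj x y) → g 1 ∈ L → g '' Set.Iio n ⊆ L := by
    intro L R hcov hs hno h1
    have step : ∀ i, i + 1 < n → g (i + 1) ∈ L := by
      intro i
      induction i with
      | zero => exact fun _ => h1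
      | succ i ih =>
        intro hi
        have hL := ih (by omega)
        by_contra hnL
        have hR := (hcov (mem _ hi)).resolve_left hnL
        refine hno _ (mem (i + 1) (by omega)) _ (mem _ hi) hL
          (fun h => hgs (i + 1) (by omega) (by omega) (hs ⟨hL, h⟩)) hR hnL ?_
        rw [hg.adj_iff _ _ (by omega) hi]
        omega
    rintro _ ⟨i, hi, rfl⟩
    rcases i with _ | i
    · by_contra hnL
      have hR := (hcov (mem 0 hi)).resolve_left hnL
      refine hno _ (mem 1 (by omega)) _ (mem 0 hi) h1
        (fun h => hgs 1 (by omega) (by omega) (hs ⟨h1, h⟩)) hR hnL ?_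
      rw [G.adj_comm, hg.adj_iff _ _ (by omega) (by omega)]
      omega
    · exact step i hi
  rcases hcov (mem 1 (by omega)) with h1 | h1
  · exact Or.inl (aux L R hcov hs hno h1)
  · refine Or.inr (aux R L (Set.union_comm L R ▸ hcov) (Set.inter_comm L R ▸ hs) ?_ h1)
    intro x hx y hy hxR hxL hyL hyR hxy
    exact hno y hy x hx hyL hyR hxR hxL hxy.symm

theorem isHoleSeq_four {V : Type u} {G : SimpleGraph V} {a b c d : V} (hab : G.Adj a b)
    (hbc : G.Adj b c) (hcd : G.Adj c d) (hda : G.Adj d a) (hac : ¬ G.Adj a c)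
    (hbd : ¬ G.Adj b d) (hac' : a ≠ c) (hbd' : b ≠ d) :
    IsHoleSeq G 4 (fun i => if i = 0 then a else if i = 1 then b else if i = 2 then c else d) := by
  refine ⟨le_rfl, ?_, ?_⟩
  · intro i j hij hj
    have h1 := hab.ne
    have h2 := hbc.ne
    have h3 := hcd.ne
    have h4 := hda.ne'
    interval_cases j <;> interval_cases i <;> simp_all
  · intro i j hij hj
    have h4 := hda.symm
    interval_cases j <;> interval_cases i <;> simp_all

theorem EvenHoleFree.no_four_cycle {V : Type u} {G : SimpleGraph V} (hEH : EvenHoleFree G)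
    {a b c d : V} (hab : G.Adj a b)
    (hbc : G.Adj b c) (hcd : G.Adj c d) (hda : G.Adj d a) (hac : ¬ G.Adj a c)
    (hbd : ¬ G.Adj b d) (hac' : a ≠ c) (hbd' : b ≠ d) : False :=
  hEH 4 _ (isHoleSeq_four hab hbc hcd hda hac hbd hac' hbd').isHoleOn (by decide)

/-- The closed neighborhood of an edge is chordal. -/
theorem chordalSet_closedNbhd_edge {V : Type u} [Finite V] {G : SimpleGraph V}
    (hEH : EvenHoleFree G) (hSW : ∀ (H : Set V) (w : V), ¬ IsSectorWheel G H w)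
    {p q : V} (hpq : G.Adj p q) :
    ChordalSet G ({u | u = p ∨ G.Adj p u} ∪ {u | u = q ∨ G.Adj q u}) := by
  intro H hsub hH
  have hp := chordalSet_closedNbhd_vertex hSW p
  have hq := chordalSet_closedNbhd_vertex hSW q
  obtain ⟨a, ha, haS⟩ := Set.not_subset.1 (fun h => hq H h hH)
  obtain ⟨b, hb, hbS⟩ := Set.not_subset.1 (fun h => hp H h hH)
  have hnoAB : ∀ x ∈ H, ∀ y ∈ H, ¬ (x = q ∨ G.Adj q x) → ¬ (y = p ∨ G.Adj p y) →
      ¬ G.Adj x y := by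
    intro x hx y hy hxq hyp hxy
    have hx' := (hsub hx).resolve_right hxq
    have hy' := (hsub hy).resolve_left hyp
    simp only [Set.mem_ofPred_eq] at hx' hy'
    push Not at hxq hyp
    have hxp : G.Adj p x := hx'.resolve_left (fun h => hxq.2 (h ▸ hpq.symm))
    have hyq : G.Adj q y := hy'.resolve_left (fun h => hyp.2 (h ▸ hpq))
    exact hEH.no_four_cycle hxp hxy hyq.symm hpq.symm hyp.2 (fun h => hxq.2 h.symm)
      (Ne.symm hyp.1) hxq.1
  have hbA : b ∉ {u | ¬ (u = q ∨ G.Adj q u)} := by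
    exact not_not_intro ((hsub hb).resolve_left hbS)
  obtain ⟨n, g, hg, h0, h1, rfl⟩ :=
    hH.exists_seq_enter (S := {u | ¬ (u = q ∨ G.Adj q u)}) ha haS hb hbA
  have hn := hg.four_le
  have mem : ∀ i, i < n → g i ∈ g '' Set.Iio n := fun i hi => ⟨i, hi, rfl⟩
  obtain ⟨t, ht, rfl⟩ := hb
  simp only [Set.mem_Iio] at ht
  simp only [Set.mem_ofPred_eq, not_not] at h0 h1 hbA hbS
  have h0p : g 0 = p ∨ G.Adj p (g 0) := by
    by_contra h
    refine hnoAB _ (mem 1 (by omega)) _ (mem 0 (by omega)) h1 h ?_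
    rw [G.adj_comm, hg.adj_iff _ _ (by omega) (by omega)]
    omega
  have ht2 : 2 ≤ t := by
    by_contra hlt
    have : t = 0 ∨ t = 1 := by omega
    rcases this with rfl | rfl
    · exact hbS h0p
    · exact h1 hbA
  have hex : ∃ m, 2 ≤ m ∧ (g m = q ∨ G.Adj q (g m)) := ⟨t, ht2, hbA⟩
  set m := Nat.find hex with hm
  obtain ⟨hm2, hmq⟩ := Nat.find_spec hex
  rw [← hm] at hm2 hmq
  have hmt : m ≤ t := Nat.find_min' hex ⟨ht2, hbA⟩
  have hmin : ∀ i, 0 < i → i < m → ¬ (g i = q ∨ G.Adj q (g i)) := by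
    intro i hi0 hi
    rcases Nat.lt_or_ge i 2 with h | h
    · obtain rfl : i = 1 := by omega
      exact h1
    · exact fun hc => Nat.find_min hex hi ⟨h, hc⟩
  have hmp : g m = p ∨ G.Adj p (g m) := by
    by_contra h
    refine hnoAB _ (mem (m - 1) (by omega)) _ (mem m (by omega))
      (hmin _ (by omega) (by omega)) h ?_
    rw [hg.adj_iff _ _ (by omega) (by omega)]
    omega
  have hmt' : m < t := lt_of_le_of_ne hmt (fun h => hbS (h ▸ hmp))
  have hne0m := hg.ne 0 m (by omega) (by omega)
  have hnadj : ¬ G.Adj (g 0) (g m) := by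
    rw [hg.adj_iff _ _ (by omega) (by omega)]
    omega
  have common : ∀ w, (g 0 = w ∨ G.Adj w (g 0)) → (g m = w ∨ G.Adj w (g m)) →
      G.Adj w (g 0) ∧ G.Adj w (g m) := by
    rintro w (rfl | h) (h' | h')
    · exact absurd h'.symm hne0m
    · exact absurd h' hnadj
    · exact absurd (h' ▸ h).symm hnadj
    · exact ⟨h, h'⟩
  obtain ⟨hq0, hqm⟩ := common q h0 hmq
  obtain ⟨hp0, hpm⟩ := common p h0p hmp
  have hgq : ∀ i, i ≤ m → g i ≠ q := by
    intro i hi he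
    rcases Nat.eq_zero_or_pos i with rfl | h
    · exact hq0.ne' he
    · rcases hi.lt_or_eq with h' | rfl
      · exact hmin i h h' (Or.inl he)
      · exact hqm.ne' he
  have hseq : IsHoleSeq G (m + 2) (fun i => if i ≤ m then g i else q) := by
    refine ⟨by omega, ?_, ?_⟩
    · intro i j hij hj
      have hi : i ≤ m := by omega
      by_cases hjm : j ≤ m
      · simpa [hi, hjm] using hg.ne i j hij (by omega)
      · simpa [hi, hjm] using hgq i hi
    · intro i j hij hj
      have hi : i ≤ m := by omega
      by_cases hjm : j ≤ m
      · simp only [hi, hjm, if_true]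
        rw [hg.adj_iff _ _ hij (by omega)]
        omega
      · simp only [hi, hjm, if_true, if_false]
        rcases Nat.eq_zero_or_pos i with rfl | h
        · simp only [hq0.symm, true_iff, true_and]
          omega
        · rcases hi.lt_or_eq with h' | rfl
          · have := hmin i h h'
            push Not at this
            simp only [G.adj_comm (g i), this.2, false_iff]
            omega
          · simp only [hqm.symm, true_iff]
            omega
  refine hp _ ?_ hseq.isHole
  rintro _ ⟨i, -, rfl⟩
  by_cases hi : i ≤ m
  · simp only [hi, if_true]
    rcases Nat.eq_zero_or_pos i with rfl | h
    · exact h0p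
    · rcases hi.lt_or_eq with h' | rfl
      · exact (hsub (mem i (by omega))).resolve_right (hmin i h h')
      · exact hmp
  · simp only [hi, if_false]
    exact Or.inr hpq

/-- `p 0, …, p (k - 1)` is a flat path. -/
structure IsFlatSeq {V : Type u} (G : SimpleGraph V) (k : ℕ) (p : ℕ → V) : Prop where
  ne : ∀ i j, i < j → j < k → p i ≠ p j
  adj_iff : ∀ i j, i < j → j < k → (G.Adj (p i) (p j) ↔ j = i + 1)
  flat : ∀ i, i + 2 < k → ∀ u, G.Adj (p (i + 1)) u → u = p i ∨ u = p (i + 2)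

theorem IsFlatSeq.reverse {V : Type u} {G : SimpleGraph V} {k : ℕ} {p : ℕ → V}
    (h : IsFlatSeq G k p) : IsFlatSeq G k (fun i => p (k - 1 - i)) := by
  refine ⟨fun i j hij hj => (h.ne _ _ (by omega) (by omega)).symm, fun i j hij hj => ?_,
    fun i hi u hu => ?_⟩
  · rw [G.adj_comm, h.adj_iff _ _ (by omega) (by omega)]
    omega
  · have := h.flat (k - 1 - (i + 2)) (by omega) u
      (by rwa [show k - 1 - (i + 2) + 1 = k - 1 - (i + 1) by omega])
    rw [show k - 1 - (i + 2) + 2 = k - 1 - i by omega] at this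
    exact this.symm

theorem image_reverse_Iio {V : Type u} (k : ℕ) (p : ℕ → V) :
    (fun i => p (k - 1 - i)) '' Set.Iio k = p '' Set.Iio k := by
  ext v
  constructor <;> rintro ⟨i, hi, rfl⟩ <;> simp only [Set.mem_Iio] at hi
  · exact ⟨k - 1 - i, by simp; omega, rfl⟩
  · exact ⟨k - 1 - i, by simp; omega, by simp only; congr 1; omega⟩

/-- Interior vertices of a flat path have no neighbors off the path. -/
theorem IsFlatSeq.not_adj {V : Type u} {G : SimpleGraph V} {k : ℕ} {p : ℕ → V}
    (h : IsFlatSeq G k p) {u : V} (hu : u ∉ p '' Set.Iio k) {i : ℕ} (h0 : 0 < i)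
    (hi : i + 1 < k) : ¬ G.Adj (p i) u := by
  obtain ⟨i, rfl⟩ : ∃ j, i = j + 1 := ⟨i - 1, by omega⟩
  intro hadj
  rcases h.flat i (by omega) u hadj with rfl | rfl
  · exact hu ⟨i, by simp; omega, rfl⟩
  · exact hu ⟨i + 2, by simp; omega, rfl⟩

/-- A common neighbor of the ends of a flat path closes it to a hole. -/
theorem IsFlatSeq.isHole_of_common {V : Type u} {G : SimpleGraph V} {k : ℕ} {p : ℕ → V}
    (h : IsFlatSeq G k p) (hk : 3 ≤ k) {c : V} (hc : c ∉ p '' Set.Iio k)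
    (h0 : G.Adj (p 0) c) (h1 : G.Adj (p (k - 1)) c) : IsHole G (insert c (p '' Set.Iio k)) := by
  have hpc : ∀ i, i < k → p i ≠ c := fun i hi he => hc ⟨i, hi, he⟩
  have hseq : IsHoleSeq G (k + 1) (fun i => if i < k then p i else c) := by
    refine ⟨by omega, ?_, ?_⟩
    · intro i j hij hj
      have hi : i < k := by omega
      by_cases hjk : j < k
      · simpa [hi, hjk] using h.ne i j hij hjk
      · simpa [hi, hjk] using hpc i hi
    · intro i j hij hj
      have hi : i < k := by omega
      by_cases hjk : j < k
      · simp only [hi, hjk, if_true]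
        rw [h.adj_iff _ _ hij hjk]
        omega
      · simp only [hi, hjk, if_true, if_false]
        by_cases hi0 : i = 0
        · subst hi0
          simp only [h0, true_iff, true_and]
          omega
        · by_cases hik : i + 1 < k
          · simp only [h.not_adj hc (by omega : 0 < i) hik, false_iff]
            omega
          · obtain rfl : i = k - 1 := by omega
            simp only [h1, true_iff]
            omega
  convert hseq.isHole using 1
  ext v
  constructor
  · rintro (rfl | ⟨i, hi, rfl⟩)
    · exact ⟨k, by simp, by simp⟩
    · simp only [Set.mem_Iio] at hi
      exact ⟨i, by simp; omega, by simp [hi]⟩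
  · rintro ⟨i, -, rfl⟩
    by_cases hi : i < k
    · simp only [hi, if_true]
      exact Or.inr ⟨i, hi, rfl⟩
    · simp [hi]

/-- An edge between private neighbors of the two ends of a flat path closes it to a hole. -/
theorem IsFlatSeq.isHole_of_edge {V : Type u} {G : SimpleGraph V} {k : ℕ} {p : ℕ → V}
    (h : IsFlatSeq G k p) (hk : 3 ≤ k) {a b : V} (ha : a ∉ p '' Set.Iio k)
    (hb : b ∉ p '' Set.Iio k) (h0a : G.Adj (p 0) a) (h1a : ¬ G.Adj (p (k - 1)) a)
    (h0b : ¬ G.Adj (p 0) b) (h1b : G.Adj (p (k - 1)) b) (hab : G.Adj a b) :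
    IsHole G (insert a (insert b (p '' Set.Iio k))) := by
  have hpa : ∀ i, i < k → p i ≠ a := fun i hi he => ha ⟨i, hi, he⟩
  have hpb : ∀ i, i < k → p i ≠ b := fun i hi he => hb ⟨i, hi, he⟩
  have hseq : IsHoleSeq G (k + 2) (fun i => if i < k then p i else if i = k then b else a) := by
    refine ⟨by omega, ?_, ?_⟩
    · intro i j hij hj
      by_cases hi : i < k
      · by_cases hjk : j < k
        · simpa [hi, hjk] using h.ne i j hij hjk
        · by_cases hjk' : j = k
          · simpa [hi, hjk'] using hpb i hi
          · simpa [hi, hjk, hjk'] using hpa i hi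
      · obtain rfl : i = k := by omega
        obtain rfl : j = i + 1 := by omega
        simpa using hab.ne'
    · intro i j hij hj
      by_cases hi : i < k
      · by_cases hjk : j < k
        · simp only [hi, hjk, if_true]
          rw [h.adj_iff _ _ hij hjk]
          omega
        · by_cases hi0 : i = 0
          · subst hi0
            by_cases hjk' : j = k
            · simp only [hi, hjk', if_true, if_false, lt_irrefl, h0b, false_iff]
              omega
            · simp only [hi, hjk, hjk', if_true, if_false, h0a, true_iff, true_and]
              omega
          · by_cases hik : i + 1 < k
            · by_cases hjk' : j = k
              · simp only [hi, hjk', if_true, if_false, lt_irrefl,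
                  h.not_adj hb (by omega : 0 < i) hik, false_iff]
                omega
              · simp only [hi, hjk, hjk', if_true, if_false,
                  h.not_adj ha (by omega : 0 < i) hik, false_iff]
                omega
            · obtain rfl : i = k - 1 := by omega
              by_cases hjk' : j = k
              · simp only [hi, hjk', if_true, if_false, lt_irrefl, h1b, true_iff]
                omega
              · simp only [hi, hjk, hjk', if_true, if_false, h1a, false_iff]
                omega
      · obtain rfl : i = k := by omega
        obtain rfl : j = i + 1 := by omega
        simpa using hab.symm
  convert hseq.isHole using 1
  ext v
  constructor
  · rintro (rfl | rfl | ⟨i, hi, rfl⟩)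
    · exact ⟨k + 1, by simp, by simp⟩
    · exact ⟨k, by simp, by simp⟩
    · simp only [Set.mem_Iio] at hi
      exact ⟨i, by simp; omega, by simp [hi]⟩
  · rintro ⟨i, -, rfl⟩
    by_cases hi : i < k
    · simp only [hi, if_true]
      exact Or.inr (Or.inr ⟨i, hi, rfl⟩)
    · by_cases hi' : i = k
      · simp [hi']
      · simp [hi, hi']

theorem isInducedPathList_triple {V : Type u} {G : SimpleGraph V} {a b c : V}
    (hab : G.Adj a b) (hbc : G.Adj b c) (hac : ¬ G.Adj a c) (hac' : a ≠ c) :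
    IsInducedPathList G [a, b, c] := by
  refine ⟨by simp, by simp [hab.ne, hbc.ne, hac'], ?_⟩
  intro i j hi hj
  simp only [List.length_cons, List.length_nil] at hi hj
  have hca : ¬ G.Adj c a := fun h => hac h.symm
  interval_cases i <;> interval_cases j <;> simp [hab, hbc, hac, hca, hab.symm, hbc.symm]

/-- The private neighborhoods of the ends of a flat path are joined by a matching. -/
theorem IsFlatSeq.nbr_unique {V : Type u} [Finite V] {G : SimpleGraph V} (hEH : EvenHoleFree G)
    (hSW : ∀ (H : Set V) (w : V), ¬ IsSectorWheel G H w) {k : ℕ} {p : ℕ → V}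
    (h : IsFlatSeq G k p) (hk : 3 ≤ k)
    (hcom : ∀ u, u ∉ p '' Set.Iio k → G.Adj (p 0) u → ¬ G.Adj (p (k - 1)) u)
    {a a' b : V} (ha : a ∉ p '' Set.Iio k) (ha' : a' ∉ p '' Set.Iio k)
    (hb : b ∉ p '' Set.Iio k) (h0a : G.Adj (p 0) a) (h0a' : G.Adj (p 0) a')
    (h1b : G.Adj (p (k - 1)) b) (hab : G.Adj a b) (hab' : G.Adj a' b) : a = a' := by
  by_contra hne
  have h0b : ¬ G.Adj (p 0) b := fun hc => hcom b hb hc h1b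
  have h0bne : p 0 ≠ b := fun he => hb ⟨0, by simp; omega, he⟩
  by_cases haa : G.Adj a a'
  · have hole := h.isHole_of_edge hk ha hb h0a (hcom a ha h0a) h0b h1b hab
    have hset : insert a (insert b (p '' Set.Iio k)) ∩ {u | G.Adj a' u} = {p 0, a, b} := by
      ext u
      constructor
      · rintro ⟨rfl | rfl | ⟨i, hi, rfl⟩, hu⟩
        · simp
        · simp
        · simp only [Set.mem_Iio] at hi
          have hu' := G.adj_symm hu
          by_cases hi0 : i = 0
          · simp [hi0]
          · by_cases hik : i + 1 < k
            · exact absurd hu' (h.not_adj ha' (by omega) hik)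
            · obtain rfl : i = k - 1 := by omega
              exact absurd hu' (hcom a' ha' h0a')
      · rintro (rfl | rfl | rfl)
        · exact ⟨Or.inr (Or.inr ⟨0, by simp; omega, rfl⟩), h0a'.symm⟩
        · exact ⟨Or.inl rfl, haa.symm⟩
        · exact ⟨Or.inr (Or.inl rfl), hab'⟩
    refine hSW _ a' ⟨⟨hole, ?_, ?_⟩, Or.inr ?_⟩
    · rintro (he | he | he)
      · exact hne he.symm
      · exact hab'.ne he
      · exact ha' he
    · rw [hset]
      exact (Set.ncard_eq_three.2 ⟨_, _, _, h0a.ne, h0bne, hab.ne, rfl⟩).ge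
    · rw [hset]
      exact ⟨[p 0, a, b], isInducedPathList_triple h0a hab h0b h0bne, by ext; simp⟩
  · exact hEH.no_four_cycle h0a hab hab'.symm h0a'.symm h0b haa h0bne hne

/-- A set of vertices around a flat path is chordal if it contains no edge between
neighbors of different ends. -/
theorem IsFlatSeq.chordalSet {V : Type u} [Finite V] {G : SimpleGraph V}
    (hSW : ∀ (H : Set V) (w : V), ¬ IsSectorWheel G H w) {k : ℕ} {p : ℕ → V}
    (h : IsFlatSeq G k p) (hk : 3 ≤ k)
    (hcom : ∀ u, u ∉ p '' Set.Iio k → G.Adj (p 0) u → ¬ G.Adj (p (k - 1)) u)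
    {X : Set V}
    (hX : ∀ v ∈ X, v ∈ p '' Set.Iio k ∨ G.Adj (p 0) v ∨ G.Adj (p (k - 1)) v)
    (hno : ∀ a ∈ X, ∀ b ∈ X, a ∉ p '' Set.Iio k → b ∉ p '' Set.Iio k → G.Adj (p 0) a →
      G.Adj (p (k - 1)) b → ¬ G.Adj a b) : ChordalSet G X := by
  intro H hsub hH
  have hcov : H ⊆ {u | u = p 0 ∨ G.Adj (p 0) u} ∪
      {u | (∃ i, 0 < i ∧ i < k ∧ u = p i) ∨ (u ∉ p '' Set.Iio k ∧ G.Adj (p (k - 1)) u)} := by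
    intro u hu
    by_cases hup : u ∈ p '' Set.Iio k
    · obtain ⟨i, hi, rfl⟩ := hup
      rcases Nat.eq_zero_or_pos i with rfl | h0
      · exact Or.inl (Or.inl rfl)
      · exact Or.inr (Or.inl ⟨i, h0, hi, rfl⟩)
    · rcases (hX u (hsub hu)).resolve_left hup with h0 | h1
      · exact Or.inl (Or.inr h0)
      · exact Or.inr (Or.inr ⟨hup, h1⟩)
  have hcut := hH.subset_or_subset_of_cut_vertex (s := p 1) hcov ?_ ?_
  · rcases hcut with hL | hR
    · exact chordalSet_closedNbhd_vertex hSW (p 0) H hL hH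
    · have hint : ∀ i, i + 2 < k → p (i + 1) ∉ H := by
        intro i
        induction i with
        | zero =>
          intro hi hmem
          obtain ⟨x, hx, y, hy, hxy, hax, hay⟩ := hH.exists_two_nbrs hmem
          have h0H : p 0 ∉ H := by
            intro h0
            rcases hR h0 with ⟨i, hi0, hik, he⟩ | ⟨hn, -⟩
            · exact h.ne 0 i hi0 hik he
            · exact hn ⟨0, by simp; omega, rfl⟩
          have h1 := h.flat 0 hi x hax
          have h2 := h.flat 0 hi y hay
          grind
        | succ i ih =>
          intro hi hmem
          obtain ⟨x, hx, y, hy, hxy, hax, hay⟩ := hH.exists_two_nbrs hmem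
          have h0H := ih (by omega)
          have h1 := h.flat (i + 1) hi x hax
          have h2 := h.flat (i + 1) hi y hay
          grind
      refine chordalSet_closedNbhd_vertex hSW (p (k - 1)) H ?_ hH
      intro u hu
      rcases hR hu with ⟨i, hi0, hik, rfl⟩ | ⟨-, hadj⟩
      · by_cases hi : i + 1 < k
        · refine absurd hu ?_
          have := hint (i - 1) (by omega)
          rwa [show i - 1 + 1 = i by omega] at this
        · exact Or.inl (by congr 1; omega)
      · exact Or.inr hadj
  · rintro u ⟨h0 | h0, ⟨i, hi0, hik, rfl⟩ | ⟨hup, h1⟩⟩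
    · exact absurd h0.symm (h.ne 0 i hi0 hik)
    · exact absurd ⟨0, by simp; omega, h0.symm⟩ hup
    · rw [h.adj_iff _ _ hi0 hik] at h0
      simp [h0]
    · exact absurd h1 (hcom u hup h0)
  · intro x hx y hy hxL hxR hyR hyL hxy
    simp only [Set.mem_ofPred_eq, not_or] at hxL hxR hyR hyL
    rcases hxL with rfl | h0x
    · exact hyL.2 hxy
    · have hxp : x ∉ p '' Set.Iio k := by
        rintro ⟨i, hi, rfl⟩
        rcases Nat.eq_zero_or_pos i with rfl | hi0
        · exact G.irrefl h0x
        · exact hxR.1 ⟨i, hi0, hi, rfl⟩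
      rcases hyR with ⟨i, hi0, hik, rfl⟩ | ⟨hyp, h1y⟩
      · by_cases hi : i + 1 < k
        · exact h.not_adj hxp hi0 hi hxy.symm
        · obtain rfl : i = k - 1 := by omega
          exact hcom x hxp h0x hxy.symm
      · exact hno x (hsub hx) y (hsub hy) hxp hyp h0x h1y hxy

theorem IsFlatPath.isFlatSeq {V : Type u} [Finite V] {G : SimpleGraph V} {l : List V}
    (hl : IsFlatPath G l) (d : V) : IsFlatSeq G l.length (fun i => l.getD i d) := by
  obtain ⟨⟨-, hnd, hadj⟩, hdeg⟩ := hl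
  have hget : ∀ i (hi : i < l.length), l.getD i d = l.get ⟨i, hi⟩ := fun i hi => by
    simp [List.getElem?_eq_getElem hi]
  have hne : ∀ i j, i < j → j < l.length → l.getD i d ≠ l.getD j d := by
    intro i j hij hj he
    rw [hget i (by omega), hget j hj] at he
    have := congrArg Fin.val (hnd.injective_get he)
    simp only at this
    omega
  refine ⟨hne, ?_, ?_⟩
  · intro i j hij hj
    rw [hget i (by omega), hget j hj, hadj]
    omega
  · intro i hi u hu
    have h2 := hdeg (i + 1) (by omega) (by omega) (by omega)
    rw [← hget] at h2
    have hsub : ({l.getD i d, l.getD (i + 2) d} : Set V) ⊆ {u | G.Adj (l.getD (i + 1) d) u} := by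
      rintro _ (rfl | rfl) <;>
      · simp only [Set.mem_ofPred_eq]
        rw [hget _ (by omega), hget _ (by omega), hadj]
        omega
    have heq := Set.eq_of_subset_of_ncard_le hsub
      (by rw [h2, Set.ncard_pair (hne _ _ (by omega) hi)])
    have : u ∈ ({l.getD i d, l.getD (i + 2) d} : Set V) := heq ▸ hu
    simpa using this

/-- A partial cover of a set with chordal induced subgraph extends. -/
theorem exists_extension_of_chordalSet {V : Type u} {G : SimpleGraph V} {P N W1 W2 : Set V}
    (hint : W1 ∩ W2 = P) (hsub : W1 ∪ W2 ⊆ N) (hN : ChordalSet G N) :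
    ∃ W1' W2' : Set V, W1 ⊆ W1' ∧ W2 ⊆ W2' ∧ W1' ∩ W2' = P ∧ W1' ∪ W2' = N ∧
      ChordalSet G W1' ∧ ChordalSet G W2' := by
  have h1 : W1 ⊆ N := Set.subset_union_left.trans hsub
  have h2 : W2 ∪ N \ W1 ⊆ N :=
    Set.union_subset (Set.subset_union_right.trans hsub) Set.sdiff_subset
  refine ⟨W1, W2 ∪ (N \ W1), subset_rfl, Set.subset_union_left, ?_, ?_,
    chordalSet_mono h1 hN, chordalSet_mono h2 hN⟩
  · subst hint
    ext v
    simp only [Set.mem_inter_iff, Set.mem_union, Set.mem_sdiff]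
    tauto
  · refine (Set.union_subset h1 h2).antisymm fun v hv => ?_
    simp only [Set.mem_union, Set.mem_sdiff]
    tauto

/-- The extension of partial covers for flat paths with at least three vertices. -/
theorem IsFlatSeq.exists_extension {V : Type u} [Finite V] {G : SimpleGraph V}
    (hEH : EvenHoleFree G) (hSW : ∀ (H : Set V) (w : V), ¬ IsSectorWheel G H w)
    {k : ℕ} {p : ℕ → V} (h : IsFlatSeq G k p) (hk : 3 ≤ k) {N W1 W2 : Set V}
    (hN : ∀ v, v ∈ N ↔ v ∈ p '' Set.Iio k ∨ G.Adj (p 0) v ∨ G.Adj (p (k - 1)) v)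
    (hint : W1 ∩ W2 = p '' Set.Iio k) (hsub : W1 ∪ W2 ⊆ N)
    (hch1 : ChordalSet G W1) (hch2 : ChordalSet G W2)
    (hcommon : {u | G.Adj (p 0) u} ∩ {u | G.Adj (p (k - 1)) u} ⊆ W1 ∪ W2) :
    ∃ W1' W2' : Set V, W1 ⊆ W1' ∧ W2 ⊆ W2' ∧ W1' ∩ W2' = p '' Set.Iio k ∧ W1' ∪ W2' = N ∧
      ChordalSet G W1' ∧ ChordalSet G W2' := by
  have hP1 : p '' Set.Iio k ⊆ W1 := hint ▸ Set.inter_subset_left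
  have hP2 : p '' Set.Iio k ⊆ W2 := hint ▸ Set.inter_subset_right
  have hcom : ∀ u, u ∉ p '' Set.Iio k → G.Adj (p 0) u → ¬ G.Adj (p (k - 1)) u := by
    intro u hu h0 h1
    have hole := h.isHole_of_common hk hu h0 h1
    rcases hcommon ⟨h0, h1⟩ with hw | hw
    · exact hch1 _ (Set.insert_subset hw hP1) hole
    · exact hch2 _ (Set.insert_subset hw hP2) hole
  have hedge : ∀ W, p '' Set.Iio k ⊆ W → ChordalSet G W → ∀ a ∈ W, ∀ b ∈ W,
      a ∉ p '' Set.Iio k → b ∉ p '' Set.Iio k → G.Adj (p 0) a →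
      G.Adj (p (k - 1)) b → ¬ G.Adj a b := by
    intro W hPW hW a ha b hb hap hbp h0 h1 hab
    exact hW _ (Set.insert_subset ha (Set.insert_subset hb hPW))
      (h.isHole_of_edge hk hap hbp h0 (hcom a hap h0) (fun hc => hcom b hbp hc h1) h1 hab)
  have huA : ∀ a a' b, a ∉ p '' Set.Iio k → a' ∉ p '' Set.Iio k → b ∉ p '' Set.Iio k →
      G.Adj (p 0) a → G.Adj (p 0) a' → G.Adj (p (k - 1)) b → G.Adj a b → G.Adj a' b → a = a' :=
    fun a a' b ha ha' hb h0 h0' h1 hab hab' =>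
      h.nbr_unique hEH hSW hk hcom ha ha' hb h0 h0' h1 hab hab'
  have huB : ∀ b b' a, b ∉ p '' Set.Iio k → b' ∉ p '' Set.Iio k → a ∉ p '' Set.Iio k →
      G.Adj (p (k - 1)) b → G.Adj (p (k - 1)) b' → G.Adj (p 0) a → G.Adj a b → G.Adj a b' →
      b = b' := by
    intro b b' a hb hb' ha h1 h1' h0 hab hab'
    have hlast : k - 1 - (k - 1) = 0 := by omega
    refine h.reverse.nbr_unique hEH hSW hk (a := b) (a' := b') (b := a) ?_ ?_ ?_ ?_ ?_ ?_ ?_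
      hab.symm hab'.symm
    · intro u hu h0 h1
      rw [image_reverse_Iio] at hu
      simp only [hlast] at h1
      exact hcom u hu h1 h0
    all_goals simpa only [image_reverse_Iio, hlast]
  have hedge1 := hedge W1 hP1 hch1
  have hedge2 := hedge W2 hP2 hch2
  have hpint : ∀ v, v ∈ W1 → v ∈ W2 → v ∈ p '' Set.Iio k := fun v h1 h2 => hint ▸ ⟨h1, h2⟩
  set P := p '' Set.Iio k with hP
  set T : Set V := {v | v ∈ N ∧ v ∉ P ∧ v ∉ W2 ∧
    ((G.Adj (p 0) v ∧ ∀ u, u ∉ P → G.Adj (p (k - 1)) u → G.Adj v u → u ∉ W1) ∨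
     (G.Adj (p (k - 1)) v ∧ ∃ u, u ∉ P ∧ G.Adj (p 0) u ∧ G.Adj u v ∧ u ∈ W2))} with hT
  have hsub1 : W1 ∪ T ⊆ N :=
    Set.union_subset (Set.subset_union_left.trans hsub) fun v hv => hv.1
  have hsub2 : W2 ∪ N \ (W1 ∪ T) ⊆ N :=
    Set.union_subset (Set.subset_union_right.trans hsub) Set.sdiff_subset
  refine ⟨W1 ∪ T, W2 ∪ (N \ (W1 ∪ T)), Set.subset_union_left, Set.subset_union_left,
    ?_, ?_, ?_, ?_⟩
  · rw [← hint]
    ext v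
    have : v ∈ T → v ∉ W2 := fun hv => hv.2.2.1
    simp only [Set.mem_inter_iff, Set.mem_union, Set.mem_sdiff]
    tauto
  · refine (Set.union_subset hsub1 hsub2).antisymm fun v hv => ?_
    simp only [Set.mem_union, Set.mem_sdiff]
    tauto
  · refine h.chordalSet hSW hk hcom (fun v hv => (hN v).1 (hsub1 hv)) ?_
    rintro a (ha | ⟨-, -, ha2, ha⟩) b (hb | ⟨-, -, hb2, hb⟩) hap hbp h0 h1 hab
    · exact hedge1 a ha b hb hap hbp h0 h1 hab
    · rcases hb with ⟨hb, -⟩ | ⟨-, u, hu, h0u, hub, huW⟩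
      · exact hcom b hbp hb h1
      · obtain rfl := huA a u b hap hu hbp h0 h0u h1 hab hub
        exact hap (hpint a ha huW)
    · rcases ha with ⟨-, ha⟩ | ⟨ha, -⟩
      · exact ha b hbp h1 hab hb
      · exact hcom a hap h0 ha
    · rcases hb with ⟨hb, -⟩ | ⟨-, u, hu, h0u, hub, huW⟩
      · exact hcom b hbp hb h1
      · obtain rfl := huA a u b hap hu hbp h0 h0u h1 hab hub
        exact ha2 huW
  · refine h.chordalSet hSW hk hcom (fun v hv => (hN v).1 (hsub2 hv)) ?_
    intro a ha b hb hap hbp h0 h1 hab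
    have hpartner : a ∉ W2 → b ∈ W1 := by
      intro haW
      obtain ⟨haN, haT⟩ := ha.resolve_left haW
      by_contra hbW
      refine haT (Or.inr ⟨haN, hap, haW, Or.inl ⟨h0, fun u hu h1u hau huW => ?_⟩⟩)
      obtain rfl := huB b u a hbp hu hap h1 h1u h0 hab hau
      exact hbW huW
    by_cases haW : a ∈ W2
    · by_cases hbW : b ∈ W2
      · exact hedge2 a haW b hbW hap hbp h0 h1 hab
      · obtain ⟨hbN, hbT⟩ := hb.resolve_left hbW
        exact hbT (Or.inr ⟨hbN, hbp, hbW, Or.inr ⟨h1, a, hap, h0, hab, haW⟩⟩)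
    · have hbW := hpartner haW
      rcases hb with hb | ⟨-, hb⟩
      · exact hbp (hpint b hbW hb)
      · exact hb (Or.inl hbW)

/-- A partial precover on a flat path can be extended to a full precover. -/
theorem stmt9 {V : Type u} [Finite V] (G : SimpleGraph V)
    (hEH : EvenHoleFree G) (hSC : ¬ HasStarCutset G)
    (hSW : ∀ (H : Set V) (w : V), ¬ IsSectorWheel G H w)
    (l : List V) (hl : IsFlatPath G l)
    (p1 pk : V) (hp1 : l.head? = some p1) (hpk : l.getLast? = some pk)
    (W1 W2 : Set V)
    (hint : W1 ∩ W2 = {v | v ∈ l})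
    (hsub : W1 ∪ W2 ⊆ ClosedNbhd G {v | v ∈ l})
    (hch1 : ChordalSet G W1) (hch2 : ChordalSet G W2)
    (hcommon : {u | G.Adj p1 u} ∩ {u | G.Adj pk u} ⊆ W1 ∪ W2) :
    ∃ W1' W2' : Set V, W1 ⊆ W1' ∧ W2 ⊆ W2' ∧ W1' ∩ W2' = {v | v ∈ l} ∧
      W1' ∪ W2' = ClosedNbhd G {v | v ∈ l} ∧
      ChordalSet G W1' ∧ ChordalSet G W2' := by
  have hseq := hl.isFlatSeq p1
  have hP : {v | v ∈ l} = (fun i => l.getD i p1) '' Set.Iio l.length := by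
    ext v
    simp only [Set.mem_ofPred_eq, Set.mem_image, Set.mem_Iio, List.mem_iff_getElem]
    constructor
    · rintro ⟨i, hi, rfl⟩
      exact ⟨i, hi, by simp [List.getElem?_eq_getElem hi]⟩
    · rintro ⟨i, hi, rfl⟩
      exact ⟨i, hi, by simp [List.getElem?_eq_getElem hi]⟩
  have hlen : 0 < l.length := List.length_pos_iff.2 hl.1.1
  have h0 : l.getD 0 p1 = p1 := by
    rw [List.head?_eq_getElem?] at hp1
    simp [hp1]
  have hlast : l.getD (l.length - 1) p1 = pk := by
    rw [List.getLast?_eq_getElem?] at hpk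
    simp [hpk]
  by_cases hk : 3 ≤ l.length
  · rw [hP] at hint ⊢
    refine hseq.exists_extension hEH hSW hk ?_ hint (hP ▸ hsub) hch1 hch2
      (by simpa only [h0, hlast] using hcommon)
    intro v
    simp only [ClosedNbhd, Set.mem_union, Set.mem_ofPred_eq]
    constructor
    · rintro (hv | ⟨_, ⟨i, hi, rfl⟩, hadj⟩)
      · exact Or.inl hv
      · by_cases hv : v ∈ (fun i => l.getD i p1) '' Set.Iio l.length
        · exact Or.inl hv
        · simp only [Set.mem_Iio] at hi
          by_cases hi0 : i = 0
          · subst hi0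
            exact Or.inr (Or.inl hadj.symm)
          · by_cases hik : i + 1 < l.length
            · exact absurd hadj.symm (hseq.not_adj hv (by omega) hik)
            · obtain rfl : i = l.length - 1 := by omega
              exact Or.inr (Or.inr hadj.symm)
    · rintro (hv | hv | hv)
      · exact Or.inl hv
      · exact Or.inr ⟨_, ⟨0, hlen, rfl⟩, hv.symm⟩
      · exact Or.inr ⟨_, ⟨l.length - 1, by simp; omega, rfl⟩, hv.symm⟩
  · refine exists_extension_of_chordalSet hint hsub ?_
    have h2 : l.length = 1 ∨ l.length = 2 := by omega
    rcases h2 with h1 | h2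
    · obtain ⟨p, rfl⟩ := List.length_eq_one_iff.1 h1
      refine chordalSet_mono ?_ (chordalSet_closedNbhd_vertex hSW p)
      rintro v (hv | ⟨s, hs, hadj⟩)
      · exact Or.inl (by simpa using hv)
      · obtain rfl : s = p := by simpa using hs
        exact Or.inr hadj.symm
    · obtain ⟨p, q, rfl⟩ := List.length_eq_two.1 h2
      have hpq : G.Adj p q := (hl.1.2.2 0 1 (by simp) (by simp)).2 (Or.inl rfl)
      refine chordalSet_mono ?_ (chordalSet_closedNbhd_edge hEH hSW hpq)
      rintro v (hv | ⟨s, hs, hadj⟩)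
      · have hv' : v = p ∨ v = q := by simpa using hv
        exact hv'.imp Or.inl Or.inl
      · have hs' : s = p ∨ s = q := by simpa using hs
        rcases hs' with rfl | rfl
        · exact Or.inl (Or.inr hadj.symm)
        · exact Or.inr (Or.inr hadj.symm)
end

section
/- Let G be a graph with no even hole and no twin wheel. Suppose G is minimal non-weakly flat path extendable, with a witness path P = v0w0 of length one and witness sets W1 and W2 satisfying W1 ∪ W2 = N[P]. Then G does not admit a full star cutset, i.e., there is no vertex v such that N[v] is a star cutset of G. -/
open Classical

universe u

/-! ### Induced paths and holes -/

/-- `f 0, …, f n` are the vertices, in order, of an induced path of `G` with `n` edges. -/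
def IndPath {V : Type u} (G : SimpleGraph V) (n : ℕ) (f : ℕ → V) : Prop :=
  (∀ i ≤ n, ∀ j ≤ n, f i = f j → i = j) ∧
    ∀ i ≤ n, ∀ j ≤ n, (G.Adj (f i) (f j) ↔ i + 1 = j ∨ j + 1 = i)

theorem ZMod.eq_add_one_iff_val {N : ℕ} (hN : 2 ≤ N) (i j : ZMod N) :
    j = i + 1 ↔ j.val = i.val + 1 ∨ (j.val = 0 ∧ i.val + 1 = N) := by
  have : NeZero N := ⟨by omega⟩
  have : Fact (1 < N) := ⟨by omega⟩
  have hi := ZMod.val_lt i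
  have hj := ZMod.val_lt j
  rw [← (ZMod.val_injective N).eq_iff, ZMod.val_add, ZMod.val_one]
  rcases Nat.lt_or_ge (i.val + 1) N with h | h
  · rw [Nat.mod_eq_of_lt h]; omega
  · have : i.val + 1 = N := by omega
    rw [this, Nat.mod_self]; omega

section Holes

variable {V : Type u} {G : SimpleGraph V}

theorem IndPath.adj_succ {n : ℕ} {f : ℕ → V} (h : IndPath G n f) {i : ℕ} (hi : i < n) :
    G.Adj (f i) (f (i + 1)) := (h.2 i hi.le (i + 1) hi).2 (Or.inl rfl)

theorem IndPath.reverse {n : ℕ} {f : ℕ → V} (h : IndPath G n f) :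
    IndPath G n (fun i => f (n - i)) := by
  refine ⟨fun i hi j hj e => ?_, fun i hi j hj => ?_⟩
  · have := h.1 _ (Nat.sub_le n i) _ (Nat.sub_le n j) e
    omega
  · rw [h.2 _ (Nat.sub_le n i) _ (Nat.sub_le n j)]
    omega

theorem IndPath.shift {n k m : ℕ} {f : ℕ → V} (h : IndPath G n f) (hk : k + m ≤ n) :
    IndPath G m (fun i => f (k + i)) := by
  refine ⟨fun i hi j hj e => ?_, fun i hi j hj => ?_⟩
  · have := h.1 _ (by omega) _ (by omega) e
    omega
  · rw [h.2 _ (by omega) _ (by omega)]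
    omega

/-- Prepend a vertex to an induced path. -/
theorem IndPath.cons {n : ℕ} {f : ℕ → V} (h : IndPath G n f) {z : V} (h0 : G.Adj z (f 0))
    (hz : ∀ i, 0 < i → i ≤ n → z ≠ f i ∧ ¬ G.Adj z (f i)) :
    IndPath G (n + 1) (fun i => if i = 0 then z else f (i - 1)) := by
  have hne : ∀ i ≤ n, z ≠ f i := by
    intro i hi
    rcases Nat.eq_zero_or_pos i with rfl | h
    · exact h0.ne
    · exact (hz i h hi).1
  have hadj : ∀ i ≤ n, (G.Adj z (f i) ↔ i = 0) := by
    intro i hi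
    rcases Nat.eq_zero_or_pos i with rfl | h
    · simp [h0]
    · simp [(hz i h hi).2]; omega
  refine ⟨fun i hi j hj e => ?_, fun i hi j hj => ?_⟩
  · by_cases hi0 : i = 0 <;> by_cases hj0 : j = 0 <;> simp only [hi0, hj0, if_true, if_false] at e ⊢
    · exact absurd e (hne _ (by omega))
    · exact absurd e.symm (hne _ (by omega))
    · have := h.1 _ (by omega) _ (by omega) e
      omega
  · by_cases hi0 : i = 0 <;> by_cases hj0 : j = 0 <;> simp only [hi0, hj0, if_true, if_false]
    · simp
    · rw [hadj _ (by omega)]; omega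
    · rw [G.adj_comm, hadj _ (by omega)]; omega
    · rw [h.2 _ (by omega) _ (by omega)]; omega

/-- A path with two edges. -/
theorem indPath_two {a b c : V} (hab : G.Adj a b) (hbc : G.Adj b c) (hac : a ≠ c)
    (hac' : ¬ G.Adj a c) : ∃ f : ℕ → V, IndPath G 2 f ∧ f 0 = a ∧ f 1 = b ∧ f 2 = c := by
  refine ⟨fun i => if i = 0 then a else if i = 1 then b else c, ⟨?_, ?_⟩, rfl, rfl, rfl⟩
  · intro i hi j hj e
    interval_cases i <;> interval_cases j <;> simp_all [hab.ne, hbc.ne, hab.ne', hbc.ne', hac.symm]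
  · intro i hi j hj
    have hca' : ¬ G.Adj c a := fun h => hac' h.symm
    interval_cases i <;> interval_cases j <;> simp_all [hab.symm, hbc.symm]

/-- Two induced paths with the same ends and anticomplete interiors form a hole. -/
theorem isHoleOn_of_paths {n m : ℕ} {f g : ℕ → V} (hf : IndPath G n f) (hg : IndPath G m g)
    (h0 : f 0 = g 0) (h1 : f n = g m) (hn : 2 ≤ n) (hm : 2 ≤ m)
    (hd : ∀ i, 0 < i → i < n → ∀ j, 0 < j → j < m → f i ≠ g j ∧ ¬ G.Adj (f i) (g j)) :
    IsHoleOn G (n + m) (f '' {i | i ≤ n} ∪ g '' {j | j ≤ m}) := by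
  have : NeZero (n + m) := ⟨by omega⟩
  have key : ∀ i ≤ n, ∀ j, 0 < j → j < m → f i ≠ g j ∧
      (G.Adj (f i) (g j) ↔ (i = 0 ∧ j = 1) ∨ (i = n ∧ j + 1 = m)) := by
    intro i hi j hj hjm
    rcases Nat.eq_zero_or_pos i with rfl | hi0
    · rw [h0]
      refine ⟨fun e => ?_, ?_⟩
      · have := hg.1 _ (by omega) _ (by omega) e
        omega
      · rw [hg.2 _ (by omega) _ (by omega)]; omega
    rcases hi.lt_or_eq with hin | rfl
    · have := hd i hi0 hin j hj hjm
      refine ⟨this.1, ⟨fun h => absurd h this.2, fun h => by omega⟩⟩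
    · rw [h1]
      refine ⟨fun e => ?_, ?_⟩
      · have := hg.1 _ (by omega) _ (by omega) e
        omega
      · rw [hg.2 _ (by omega) _ (by omega)]; omega
  refine ⟨by omega, fun z => if z.val ≤ n then f z.val else g (n + m - z.val), ?_, ?_, ?_⟩
  · intro x y e
    have hx := ZMod.val_lt x
    have hy := ZMod.val_lt y
    apply ZMod.val_injective
    by_cases hxn : x.val ≤ n <;> by_cases hyn : y.val ≤ n <;>
      simp only [hxn, hyn, if_true, if_false] at e
    · exact hf.1 _ hxn _ hyn e
    · exact absurd e (key _ hxn _ (by omega) (by omega)).1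
    · exact absurd e.symm (key _ hyn _ (by omega) (by omega)).1
    · have := hg.1 _ (by omega) _ (by omega) e
      omega
  · ext y
    constructor
    · rintro ⟨x, rfl⟩
      have hx := ZMod.val_lt x
      by_cases hxn : x.val ≤ n
      · left; exact ⟨x.val, hxn, by simp [hxn]⟩
      · right; exact ⟨n + m - x.val, by simp; omega, by simp [hxn]⟩
    · have hmem : ∀ i ≤ n, f i ∈ Set.range
          (fun z : ZMod (n + m) => if z.val ≤ n then f z.val else g (n + m - z.val)) := by
        intro i hi
        have hv : ((i : ℕ) : ZMod (n + m)).val = i := ZMod.val_cast_of_lt (by omega)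
        exact ⟨(i : ZMod (n + m)), by simp only [hv, hi, if_true]⟩
      rintro (⟨i, hi, rfl⟩ | ⟨j, hj, rfl⟩)
      · exact hmem i hi
      · simp only [Set.mem_ofPred_eq] at hj
        rcases Nat.eq_zero_or_pos j with rfl | hj0
        · rw [← h0]; exact hmem 0 (by omega)
        rcases hj.lt_or_eq with hjm | rfl
        · have hv : ((n + m - j : ℕ) : ZMod (n + m)).val = n + m - j :=
            ZMod.val_cast_of_lt (by omega)
          refine ⟨((n + m - j : ℕ) : ZMod (n + m)), ?_⟩
          have h2 : ¬ (n + m - j ≤ n) := by omega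
          have h3 : n + m - (n + m - j) = j := by omega
          simp only [hv, h2, if_false, h3]
        · rw [← h1]; exact hmem n le_rfl
  · intro x y
    have hx := ZMod.val_lt x
    have hy := ZMod.val_lt y
    rw [ZMod.eq_add_one_iff_val (by omega), ZMod.eq_add_one_iff_val (by omega)]
    by_cases hxn : x.val ≤ n <;> by_cases hyn : y.val ≤ n <;>
      simp only [hxn, hyn, if_true, if_false]
    · rw [hf.2 _ hxn _ hyn]; omega
    · rw [(key _ hxn _ (by omega) (by omega)).2]; omega
    · rw [G.adj_comm, (key _ hyn _ (by omega) (by omega)).2]; omega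
    · rw [hg.2 _ (by omega) _ (by omega)]; omega

/-- A hole minus a vertex is an induced path. -/
theorem IsHoleOn.open_at {n : ℕ} {H : Set V} (h : IsHoleOn G n H) {z : V} (hz : z ∈ H) :
    ∃ p : ℕ → V, IndPath G (n - 2) p ∧ (∀ i ≤ n - 2, p i ∈ H ∧ p i ≠ z) ∧
      (∀ y ∈ H, y = z ∨ ∃ i ≤ n - 2, p i = y) ∧
      ∀ i ≤ n - 2, (G.Adj z (p i) ↔ i = 0 ∨ i = n - 2) := by
  obtain ⟨hn, F, hF, rfl, hadj⟩ := h
  obtain ⟨k, rfl⟩ := hz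
  have : NeZero n := ⟨by omega⟩
  have hcast : ∀ a b : ℕ, a < n → b < n → ((a : ZMod n) = b ↔ a = b) := by
    intro a b ha hb
    rw [ZMod.natCast_eq_natCast_iff', Nat.mod_eq_of_lt ha, Nat.mod_eq_of_lt hb]
  refine ⟨fun i => F (k + 1 + i), ⟨?_, ?_⟩, ?_, ?_, ?_⟩
  · intro i hi j hj e
    have := hF e
    rw [add_right_inj] at this
    exact (hcast i j (by omega) (by omega)).1 this
  · intro i hi j hj
    rw [hadj]
    have e1 : (k + 1 + (j : ZMod n) = k + 1 + i + 1) ↔ i + 1 = j := by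
      rw [add_assoc (k + 1), add_right_inj, ← hcast (i + 1) j (by omega) (by omega)]
      push_cast
      exact eq_comm
    have e2 : (k + 1 + (i : ZMod n) = k + 1 + j + 1) ↔ j + 1 = i := by
      rw [add_assoc (k + 1), add_right_inj, ← hcast (j + 1) i (by omega) (by omega)]
      push_cast
      exact eq_comm
    rw [e1, e2]
  · intro i hi
    refine ⟨⟨_, rfl⟩, fun e => ?_⟩
    have := hF e
    have h2 : ((i + 1 : ℕ) : ZMod n) = (0 : ℕ) := by
      push_cast
      linear_combination this
    rw [hcast _ _ (by omega) (by omega)] at h2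
    omega
  · rintro _ ⟨j, rfl⟩
    by_cases hj : j = k
    · left; rw [hj]
    · right
      refine ⟨(j - k - 1).val, ?_, ?_⟩
      · have h1 := ZMod.val_lt (j - k - 1)
        by_contra h2
        have h3 : (j - k - 1).val + 1 = n := by omega
        apply hj
        have h4 : (((j - k - 1).val + 1 : ℕ) : ZMod n) = 0 := by rw [h3]; simp
        push_cast at h4
        rw [ZMod.natCast_zmod_val] at h4
        linear_combination h4
      · simp only [ZMod.natCast_zmod_val]
        congr 1; ring
  · intro i hi
    rw [hadj]
    have e1 : (k + 1 + (i : ZMod n) = k + 1) ↔ i = 0 := by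
      rw [add_eq_left]
      rw [← hcast i 0 (by omega) (by omega)]; simp
    have e2 : (k = k + 1 + (i : ZMod n) + 1) ↔ i = n - 2 := by
      have : ((n - 2 : ℕ) : ZMod n) = -2 := by
        rw [Nat.cast_sub (by omega)]; simp
      rw [← hcast i (n - 2) (by omega) (by omega), this]
      constructor
      · intro h; linear_combination -h
      · intro h; rw [h]; ring
    rw [e1, e2]

theorem IsHole.not_complete {H : Set V} (h : IsHole G H) {z : V} (hz : z ∈ H) :
    ∃ y ∈ H, y ≠ z ∧ ¬ G.Adj z y := by
  obtain ⟨n, hn⟩ := h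
  obtain ⟨p, -, hpH, -, hp⟩ := hn.open_at hz
  have := hn.1
  refine ⟨p 1, (hpH 1 (by omega)).1, (hpH 1 (by omega)).2, ?_⟩
  rw [hp 1 (by omega)]
  omega

theorem ChordalSet.mono {X Y : Set V} (h : ChordalSet G Y) (hXY : X ⊆ Y) : ChordalSet G X :=
  fun H hH => h H (hH.trans hXY)

theorem ChordalSet.not_paths {X : Set V} (hX : ChordalSet G X) {n m : ℕ} {f g : ℕ → V}
    (hf : IndPath G n f) (hg : IndPath G m g)
    (h0 : f 0 = g 0) (h1 : f n = g m) (hn : 2 ≤ n) (hm : 2 ≤ m)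
    (hd : ∀ i, 0 < i → i < n → ∀ j, 0 < j → j < m → f i ≠ g j ∧ ¬ G.Adj (f i) (g j))
    (hfX : ∀ i ≤ n, f i ∈ X) (hgX : ∀ j ≤ m, g j ∈ X) : False := by
  refine hX _ ?_ ⟨_, isHoleOn_of_paths hf hg h0 h1 hn hm hd⟩
  rintro _ (⟨i, hi, rfl⟩ | ⟨j, hj, rfl⟩)
  · exact hfX i hi
  · exact hgX j hj

theorem EvenHoleFree.odd_paths (hE : EvenHoleFree G) {n m : ℕ} {f g : ℕ → V}
    (hf : IndPath G n f) (hg : IndPath G m g)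
    (h0 : f 0 = g 0) (h1 : f n = g m) (hn : 2 ≤ n) (hm : 2 ≤ m)
    (hd : ∀ i, 0 < i → i < n → ∀ j, 0 < j → j < m → f i ≠ g j ∧ ¬ G.Adj (f i) (g j)) :
    Odd (n + m) :=
  Nat.not_even_iff_odd.1 (hE _ _ (isHoleOn_of_paths hf hg h0 h1 hn hm hd))

theorem EvenHoleFree.no_square (hE : EvenHoleFree G) {a b c d : V} (hab : G.Adj a b)
    (hbc : G.Adj b c) (hcd : G.Adj c d) (hda : G.Adj d a) (hac : ¬ G.Adj a c) (hbd : ¬ G.Adj b d)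
    (hac' : a ≠ c) (hbd' : b ≠ d) : False := by
  obtain ⟨f, hf, f0, f1, f2⟩ := indPath_two hab hbc hac' hac
  obtain ⟨g, hg, g0, g1, g2⟩ := indPath_two hda.symm hcd.symm hac' hac
  have := hE.odd_paths hf hg (by rw [f0, g0]) (by rw [f2, g2]) le_rfl le_rfl (by
    intro i hi hi' j hj hj'
    obtain rfl : i = 1 := by omega
    obtain rfl : j = 1 := by omega
    rw [f1, g1]
    exact ⟨hbd', hbd⟩)
  exact absurd this (by decide)

/-- If `w` sees both ends of an induced path and the path with `w` is chordal, then `w` sees the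
whole path. -/
theorem IndPath.adj_of_chordal {X : Set V} (hX : ChordalSet G X) {m : ℕ} {p : ℕ → V}
    (hp : IndPath G m p) {w : V} (h0 : G.Adj w (p 0)) (hm : G.Adj w (p m))
    (hpX : ∀ i ≤ m, p i ∈ X) (hwX : w ∈ X) (hw : ∀ i ≤ m, p i ≠ w) :
    ∀ i ≤ m, G.Adj w (p i) := by
  by_contra! hcon
  obtain ⟨i, him, hi⟩ := hcon
  have hex : ∃ k, i + k ≤ m ∧ G.Adj w (p (i + k)) := ⟨m - i, by omega, by
    rwa [Nat.add_sub_cancel' him]⟩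
  have hex' : ∃ k, k ≤ i ∧ G.Adj w (p (i - k)) := ⟨i, le_rfl, by simpa using h0⟩
  obtain ⟨hb1, hb2⟩ := Nat.find_spec hex
  obtain ⟨ha1, ha2⟩ := Nat.find_spec hex'
  have hbm := fun k hk => Nat.find_min hex (m := k) hk
  have ham := fun k hk => Nat.find_min hex' (m := k) hk
  set b := Nat.find hex
  set a := Nat.find hex'
  have hb0 : b ≠ 0 := by intro h; rw [h] at hb2; exact hi hb2
  have ha0 : a ≠ 0 := by intro h; rw [h] at ha2; exact hi ha2
  have hne : p (i - a) ≠ p (i + b) := by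
    intro e
    have := hp.1 _ (by omega) _ (by omega) e
    omega
  obtain ⟨g, hg, g0, g1, g2⟩ := indPath_two ha2.symm hb2 hne (by
    rw [hp.2 _ (by omega) _ (by omega)]; omega)
  refine hX.not_paths (hp.shift (k := i - a) (m := a + b) (by omega)) hg (by simp [g0])
    (by simp only [g2]; congr 1; omega) (by omega) le_rfl ?_ (fun j hj => hpX _ (by omega)) ?_
  · intro j hj hj' j' hj'0 hj'2
    obtain rfl : j' = 1 := by omega
    rw [g1]
    refine ⟨hw _ (by omega), fun hadj => ?_⟩
    rcases Nat.lt_trichotomy (i - a + j) i with h | h | h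
    · refine ham (a - j) (by omega) ⟨by omega, ?_⟩
      rw [show i - (a - j) = i - a + j by omega]
      exact hadj.symm
    · rw [h] at hadj; exact hi hadj.symm
    · refine hbm (j - a) (by omega) ⟨by omega, ?_⟩
      rw [show i + (j - a) = i - a + j by omega]
      exact hadj.symm
  · intro j hj
    interval_cases j
    · rw [g0]; exact hpX _ (by omega)
    · rw [g1]; exact hwX
    · rw [g2]; exact hpX _ (by omega)

end Holes

/-! ### Walks and shortest paths -/

section Walks

variable {V : Type u} {G : SimpleGraph V}

/-- Every walk can be shortened to an induced path. -/
theorem exists_indPath_of_walk {S : Set V} (n : ℕ) (f : ℕ → V)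
    (hf : ∀ i < n, G.Adj (f i) (f (i + 1))) (hS : ∀ i, 0 < i → i < n → f i ∈ S) :
    ∃ m ≤ n, ∃ g : ℕ → V, IndPath G m g ∧ g 0 = f 0 ∧ g m = f n ∧
      ∀ i, 0 < i → i < m → g i ∈ S := by
  induction n using Nat.strong_induction_on generalizing f with
  | _ n ih =>
  have cut : ∀ i d, 0 < d → i + d ≤ n → (f i = f (i + d)) → ∃ m ≤ n, ∃ g : ℕ → V,
      IndPath G m g ∧ g 0 = f 0 ∧ g m = f n ∧ ∀ i, 0 < i → i < m → g i ∈ S := by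
    intro i d hd hid e
    obtain ⟨m, hm, g, hg, g0, gm, hgS⟩ := ih (n - d) (by omega)
      (fun k => if k ≤ i then f k else f (k + d)) (by
        intro k hk
        rcases Nat.lt_trichotomy k i with h | rfl | h
        · rw [if_pos h.le, if_pos (by omega)]; exact hf _ (by omega)
        · rw [if_pos le_rfl, if_neg (by omega), e, show k + 1 + d = k + d + 1 by omega]
          exact hf _ (by omega)
        · rw [if_neg (by omega), if_neg (by omega), show k + 1 + d = k + d + 1 by omega]
          exact hf _ (by omega)) (by
        intro k hk hkn
        split_ifs
        · exact hS _ hk (by omega)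
        · exact hS _ (by omega) (by omega))
    refine ⟨m, by omega, g, hg, by simpa using g0, ?_, hgS⟩
    rw [gm]
    split_ifs with h
    · rw [show n - d = i by omega, e, show i + d = n by omega]
    · rw [Nat.sub_add_cancel (by omega)]
  have cut' : ∀ i d, 0 < d → i + d + 1 ≤ n → G.Adj (f i) (f (i + d + 1)) → ∃ m ≤ n,
      ∃ g : ℕ → V,
      IndPath G m g ∧ g 0 = f 0 ∧ g m = f n ∧ ∀ i, 0 < i → i < m → g i ∈ S := by
    intro i d hd hid e
    obtain ⟨m, hm, g, hg, g0, gm, hgS⟩ := ih (n - d) (by omega)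
      (fun k => if k ≤ i then f k else f (k + d)) (by
        intro k hk
        rcases Nat.lt_trichotomy k i with h | rfl | h
        · rw [if_pos h.le, if_pos (by omega)]; exact hf _ (by omega)
        · rw [if_pos le_rfl, if_neg (by omega), show k + 1 + d = k + d + 1 by omega]
          exact e
        · rw [if_neg (by omega), if_neg (by omega), show k + 1 + d = k + d + 1 by omega]
          exact hf _ (by omega)) (by
        intro k hk hkn
        split_ifs
        · exact hS _ hk (by omega)
        · exact hS _ (by omega) (by omega))
    refine ⟨m, by omega, g, hg, by simpa using g0, ?_, hgS⟩
    rw [gm, if_neg (by omega), Nat.sub_add_cancel (by omega)]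
  by_contra hcon
  refine hcon ⟨n, le_rfl, f, ⟨?_, ?_⟩, rfl, rfl, hS⟩
  · intro i hi j hj e
    by_contra hne
    rcases Nat.lt_or_gt_of_ne hne with h | h
    · exact hcon (cut i (j - i) (by omega) (by omega) (by rw [e]; congr 1; omega))
    · exact hcon (cut j (i - j) (by omega) (by omega) (by rw [← e]; congr 1; omega))
  · intro i hi j hj
    constructor
    · intro e
      by_contra! hne
      rcases Nat.lt_trichotomy i j with h | rfl | h
      · exact hcon (cut' i (j - i - 1) (by omega) (by omega)
          (by rw [show i + (j - i - 1) + 1 = j by omega]; exact e))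
      · exact G.loopless.irrefl _ e
      · exact hcon (cut' j (i - j - 1) (by omega) (by omega)
          (by rw [show j + (i - j - 1) + 1 = i by omega]; exact e.symm))
    · rintro (rfl | rfl)
      · exact hf _ (by omega)
      · exact (hf _ (by omega)).symm

/-- `b` can be reached from `a` along a walk whose vertices other than `a` lie in `S`. -/
def ReachIn {V : Type u} (G : SimpleGraph V) (S : Set V) : V → V → Prop :=
  Relation.ReflTransGen fun x y => G.Adj x y ∧ y ∈ S

theorem ReachIn.mono {S T : Set V} (hST : S ⊆ T) {a b : V} (h : ReachIn G S a b) :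
    ReachIn G T a b :=
  Relation.ReflTransGen.mono (fun _ _ (hxy : G.Adj _ _ ∧ _) => ⟨hxy.1, hST hxy.2⟩) a b h

theorem ReachIn.mem {S : Set V} {a b : V} (h : ReachIn G S a b) (ha : a ∈ S) : b ∈ S := by
  rcases Relation.ReflTransGen.cases_tail h with rfl | ⟨c, -, hc⟩
  exacts [ha, hc.2]

theorem ReachIn.head {S : Set V} {a b c : V} (h : ReachIn G S b c) (hab : G.Adj a b)
    (hb : b ∈ S) : ReachIn G S a c :=
  Relation.ReflTransGen.head ⟨hab, hb⟩ h

theorem ReachIn.symm {S : Set V} {a b : V} (h : ReachIn G S a b) (ha : a ∈ S) :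
    ReachIn G S b a := by
  induction h with
  | refl => exact .refl
  | tail h1 h2 ih => exact ReachIn.head ih h2.1.symm (ReachIn.mem h1 ha)

/-- Restrict a walk to a part that it cannot leave. -/
theorem ReachIn.inter {S T : Set V} {a b : V} (h : ReachIn G S a b) (ha : a ∈ T)
    (hT : ∀ x ∈ T, ∀ y ∈ S, G.Adj x y → y ∈ T) : ReachIn G (S ∩ T) a b := by
  have : ReachIn G (S ∩ T) a b ∧ b ∈ T := by
    induction h with
    | refl => exact ⟨.refl, ha⟩
    | tail _ h2 ih =>
      have := hT _ ih.2 _ h2.2 h2.1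
      exact ⟨.tail ih.1 ⟨h2.1, h2.2, this⟩, this⟩
  exact this.1

theorem ReachIn.exists_walk {S : Set V} {a b : V} (h : ReachIn G S a b) :
    ∃ (n : ℕ) (f : ℕ → V), f 0 = a ∧ f n = b ∧ (∀ i < n, G.Adj (f i) (f (i + 1))) ∧
      ∀ i, 0 < i → i ≤ n → f i ∈ S := by
  induction h with
  | refl => exact ⟨0, fun _ => a, rfl, rfl, fun i hi => absurd hi (Nat.not_lt_zero i),
      fun i hi hi' => by omega⟩
  | @tail b c _ h2 ih =>
    obtain ⟨n, f, f0, fn, hf, hS⟩ := ih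
    refine ⟨n + 1, fun i => if i ≤ n then f i else c, by simpa using f0, by simp, ?_, ?_⟩
    · intro i hi
      dsimp only
      rcases Nat.lt_or_ge i n with h | h
      · rw [if_pos h.le, if_pos (by omega)]; exact hf i h
      · obtain rfl : i = n := by omega
        rw [if_pos le_rfl, if_neg (by omega), fn]; exact h2.1
    · intro i hi hi'
      dsimp only
      split_ifs with h
      · exact hS i hi h
      · exact h2.2

/-- A shortest path with prescribed interior. -/
theorem ReachIn.exists_indPath {S : Set V} {a b c : V} (h : ReachIn G S a b) (hbc : G.Adj b c) :
    ∃ (n : ℕ) (f : ℕ → V), IndPath G n f ∧ f 0 = a ∧ f n = c ∧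
      ∀ i, 0 < i → i < n → f i ∈ S := by
  obtain ⟨n, f, f0, fn, hf, hS⟩ := h.exists_walk
  obtain ⟨m, -, g, hg, g0, gm, hgS⟩ := exists_indPath_of_walk (S := S) (n + 1)
    (fun i => if i ≤ n then f i else c) (by
      intro i hi
      rcases Nat.lt_or_ge i n with h | h
      · rw [if_pos h.le, if_pos (by omega)]; exact hf i h
      · obtain rfl : i = n := by omega
        rw [if_pos le_rfl, if_neg (by omega), fn]; exact hbc) (by
      intro i hi hi'
      rw [if_pos (by omega)]
      exact hS i hi (by omega))
  exact ⟨m, g, hg, by simpa [f0] using g0, by simpa using gm, hgS⟩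

end Walks

/-! ### Induced subgraphs and minimality -/

section Induce

variable {V : Type u} {G : SimpleGraph V}

theorem isHole_induce {S : Set V} {H : Set S} :
    IsHole (G.induce S) H ↔ IsHole G (Subtype.val '' H) := by
  constructor
  · rintro ⟨n, hn, f, hf, rfl, hadj⟩
    exact ⟨n, hn, fun i => (f i : V), Subtype.val_injective.comp hf, by rw [← Set.range_comp]; rfl,
      fun i j => hadj i j⟩
  · rintro ⟨n, hn, f, hf, hr, hadj⟩
    have hmem : ∀ i, ∃ s ∈ H, (s : V) = f i := fun i => by
      have : f i ∈ Subtype.val '' H := hr ▸ Set.mem_range_self i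
      exact this
    choose g hgH hg using hmem
    refine ⟨n, hn, g, fun i j e => hf (by rw [← hg, ← hg, e]), ?_, fun i j => ?_⟩
    · ext s
      constructor
      · rintro ⟨i, rfl⟩; exact hgH i
      · intro hs
        have : (s : V) ∈ Set.range f := hr ▸ ⟨s, hs, rfl⟩
        obtain ⟨i, hi⟩ := this
        exact ⟨i, Subtype.ext ((hg i).trans hi)⟩
    · rw [← hadj, ← hg, ← hg]; rfl

theorem chordalSet_induce {S : Set V} {X : Set S} :
    ChordalSet (G.induce S) X ↔ ChordalSet G (Subtype.val '' X) := by
  constructor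
  · intro h H hH hole
    have e : Subtype.val '' (Subtype.val ⁻¹' H : Set S) = H := by
      rw [Subtype.image_preimage_coe]
      refine Set.inter_eq_right.2 (hH.trans ?_)
      rintro _ ⟨s, -, rfl⟩
      exact s.2
    refine h (Subtype.val ⁻¹' H) ?_ (isHole_induce.2 (e.symm ▸ hole))
    intro s hs
    obtain ⟨t, ht, hts⟩ := hH hs
    exact Subtype.ext hts ▸ ht
  · intro h H hH hole
    exact h _ (Set.image_mono hH) (isHole_induce.1 hole)

theorem isInducedPathList_singleton {a : V} : IsInducedPathList G [a] := by
  refine ⟨by simp, by simp, fun i j hi hj => ?_⟩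
  simp only [List.length_singleton, Nat.lt_one_iff] at hi hj
  subst hi hj
  simp

theorem isInducedPathList_pair {a b : V} (h : G.Adj a b) : IsInducedPathList G [a, b] := by
  refine ⟨by simp, by simp [h.ne], fun i j hi hj => ?_⟩
  simp only [List.length_cons, List.length_nil] at hi hj
  have := h.symm
  interval_cases i <;> interval_cases j <;> simp_all

theorem exists_extension {S : Set V} (hS : WeaklyFPE (G.induce S)) {l : List V}
    (hl : IsInducedPathList G l) (hl2 : l.length ≤ 2) (hlS : ∀ v ∈ l, v ∈ S) {W1 W2 : Set V}
    (hW1S : W1 ⊆ S) (hW2S : W2 ⊆ S) (hW1 : ChordalSet G W1) (hW2 : ChordalSet G W2)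
    (hI : W1 ∩ W2 = {v | v ∈ l}) (hU : W1 ∪ W2 = ClosedNbhd G {v | v ∈ l} ∩ S) :
    ∃ X1 X2 : Set V, W1 ⊆ X1 ∧ W2 ⊆ X2 ∧ ChordalSet G X1 ∧ ChordalSet G X2 ∧
      X1 ∩ X2 = {v | v ∈ l} ∧ X1 ∪ X2 = S := by
  lift l to List S using hlS
  have eI : ∀ W : Set V, W ⊆ S → Subtype.val '' (Subtype.val ⁻¹' W : Set S) = W := fun W hW => by
    rw [Subtype.image_preimage_coe]
    exact Set.inter_eq_right.2 hW
  have el : {v : V | v ∈ l.map Subtype.val} = Subtype.val '' {s : S | s ∈ l} := by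
    ext; simp
  have epre : {s : S | s ∈ l} = Subtype.val ⁻¹' {v : V | v ∈ l.map Subtype.val} := by
    ext; simp
  have hl' : IsInducedPathList (G.induce S) l := by
    obtain ⟨h1, h2, h3⟩ := hl
    refine ⟨by rintro rfl; simp at h1, List.Nodup.of_map _ h2, fun i j hi hj => ?_⟩
    have := h3 i j (by simpa using hi) (by simpa using hj)
    rw [← this]
    simp
  obtain ⟨Y1, Y2, h1, h2, c1, c2, hYI, hYU⟩ := hS l hl' (by simpa using hl2)
    (Subtype.val ⁻¹' W1) (Subtype.val ⁻¹' W2)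
    (chordalSet_induce.2 (by rwa [eI _ hW1S])) (chordalSet_induce.2 (by rwa [eI _ hW2S]))
    (by rw [← Set.preimage_inter, hI, epre]) (by
      rw [← Set.preimage_union, hU]
      ext s
      simp [ClosedNbhd])
  refine ⟨Subtype.val '' Y1, Subtype.val '' Y2, ?_, ?_, chordalSet_induce.1 c1,
    chordalSet_induce.1 c2, ?_, ?_⟩
  · rw [← eI _ hW1S]; exact Set.image_mono h1
  · rw [← eI _ hW2S]; exact Set.image_mono h2
  · rw [← Set.image_inter Subtype.val_injective, hYI, el]
  · rw [← Set.image_union, hYU]; simp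

end Induce

/-! ### Gluing and deleting -/

section Witness

variable {V : Type u} {G : SimpleGraph V}

theorem mem_closedNbhd {S : Set V} {x : V} :
    x ∈ ClosedNbhd G S ↔ x ∈ S ∨ ∃ s ∈ S, G.Adj x s := Iff.rfl

/-- Two vertices with neighbors in a clique, or in it, are joined by a path through the clique. -/
theorem exists_indPath_through_clique {L : Set V} (hL : G.IsClique L) {a b : V}
    (ha : a ∈ ClosedNbhd G L) (hb : b ∈ ClosedNbhd G L) (hab : a ≠ b) :
    ∃ (n : ℕ) (f : ℕ → V), IndPath G n f ∧ f 0 = a ∧ f n = b ∧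
      ∀ i, 0 < i → i < n → f i ∈ L := by
  have h1 : ∃ x ∈ L, ReachIn G L a x := by
    rcases ha with ha | ⟨x, hx, h⟩
    · exact ⟨a, ha, .refl⟩
    · exact ⟨x, hx, .single ⟨h, hx⟩⟩
  obtain ⟨x, hx, hax⟩ := h1
  have h2 : ∀ y ∈ L, ReachIn G L a y := fun y hy => by
    by_cases hxy : x = y
    · exact hxy ▸ hax
    · exact .tail hax ⟨hL hx hy hxy, hy⟩
  rcases hb with hb | ⟨y, hy, h⟩
  · rcases Relation.ReflTransGen.cases_tail (h2 b hb) with h | ⟨c, hc, hcb⟩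
    · exact absurd h.symm hab
    · exact ReachIn.exists_indPath hc hcb.1
  · exact (h2 y hy).exists_indPath h.symm

theorem ChordalSet.glue {X Y U N : Set V} {L : Set V} (hX : ChordalSet G X) (hY : ChordalSet G Y)
    (hL : G.IsClique L) (hN : N ⊆ ClosedNbhd G L) (hUL : ∀ u ∈ U, u ∉ ClosedNbhd G L)
    (hU : ∀ u ∈ U, ∀ y, G.Adj u y → y ∈ U ∨ y ∈ N) (hXU : ∀ u ∈ U, u ∉ X) (hXN : X ∩ N ⊆ Y)
    (hLY : L ⊆ Y) :
    ChordalSet G (X ∪ Y ∩ U) := by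
  intro H hH hole
  by_cases h1 : ∃ u ∈ H, u ∈ U
  swap
  · push Not at h1
    exact hX H (fun h hh => (hH hh).resolve_right fun h2 => h1 h hh h2.2) hole
  by_cases h2 : ∃ z ∈ H, z ∉ U ∧ z ∉ N
  swap
  · push Not at h2
    refine hY H (fun h hh => ?_) hole
    rcases hH hh with h3 | h3
    · exact hXN ⟨h3, h2 h hh fun hu => hXU h hu h3⟩
    · exact h3.1
  obtain ⟨u, huH, hu⟩ := h1
  obtain ⟨z, hzH, hzU, hzN⟩ := h2
  obtain ⟨n, hn⟩ := hole
  obtain ⟨p, hp, hpH, hpy, hpz⟩ := hn.open_at hzH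
  have hn4 := hn.1
  generalize hm : n - 2 = m at *
  have hend : ∀ i ≤ m, p i ∈ U → 0 < i ∧ i < m := by
    intro i hi hiU
    have h3 : ¬ G.Adj z (p i) := fun h => by
      rcases hU _ hiU z h.symm with h | h
      exacts [hzU h, hzN h]
    rw [hpz i hi] at h3
    omega
  obtain ⟨k, hkm, rfl⟩ := (hpy u huH).resolve_left (by rintro rfl; exact hzU hu)
  have hkk := hend k hkm hu
  have hex : ∃ j, k + j ≤ m ∧ p (k + j) ∉ U :=
    ⟨m - k, by omega, fun h => by have := hend _ (by omega) h; omega⟩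
  have hex' : ∃ j, j ≤ k ∧ p (k - j) ∉ U :=
    ⟨k, le_rfl, fun h => by have := hend _ (by omega) h; omega⟩
  obtain ⟨hb1, hb2⟩ := Nat.find_spec hex
  obtain ⟨ha1, ha2⟩ := Nat.find_spec hex'
  have hbm := fun j hj => Nat.find_min hex (m := j) hj
  have ham := fun j hj => Nat.find_min hex' (m := j) hj
  set b := Nat.find hex
  set a := Nat.find hex'
  have hb0 : b ≠ 0 := by intro h; rw [h] at hb2; exact hb2 hu
  have ha0 : a ≠ 0 := by intro h; rw [h] at ha2; exact ha2 hu
  have hin : ∀ i, k - a < i → i < k + b → p i ∈ U := by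
    intro i hi hi'
    by_contra hcon
    rcases Nat.lt_or_ge i k with h | h
    · exact ham (k - i) (by omega) ⟨by omega, by rwa [show k - (k - i) = i by omega]⟩
    · exact hbm (i - k) (by omega) ⟨by omega, by rwa [show k + (i - k) = i by omega]⟩
  have hpY : ∀ i, i ≤ m → p i ∈ U → p i ∈ Y := fun i hi hiU =>
    ((hH (hpH i hi).1).resolve_left (hXU _ hiU)).1
  have hbN : p (k + b) ∈ N := by
    have := hp.adj_succ (i := k + b - 1) (by omega)
    rw [show k + b - 1 + 1 = k + b by omega] at this
    exact (hU _ (hin _ (by omega) (by omega)) _ this).resolve_left hb2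
  have haN : p (k - a) ∈ N :=
    (hU _ (hin _ (by omega) (by omega)) _ (hp.adj_succ (i := k - a) (by omega)).symm).resolve_left
      ha2
  have hNY : ∀ i ≤ m, p i ∉ U → p i ∈ N → p i ∈ Y := fun i hi hiU hiN =>
    hXN ⟨(hH (hpH i hi).1).resolve_right fun h => hiU h.2, hiN⟩
  have hne : p (k - a) ≠ p (k + b) := by
    intro e
    have := hp.1 _ (by omega) _ (by omega) e
    omega
  obtain ⟨l, q, hq, q0, ql, hqL⟩ := exists_indPath_through_clique hL (hN haN) (hN hbN) hne
  have hl2 : 2 ≤ l := by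
    by_contra hl
    obtain rfl | rfl : l = 0 ∨ l = 1 := by omega
    · exact hne (q0.symm.trans ql)
    · have := hq.adj_succ (i := 0) (by omega)
      rw [q0, ql, hp.2 _ (by omega) _ (by omega)] at this
      omega
  refine hY.not_paths (hp.shift (k := k - a) (m := a + b) (by omega)) hq (by simp [q0])
    (by simp only [ql]; congr 1; omega) (by omega) hl2 ?_ ?_ ?_
  · intro i hi hi' j hj hj'
    have h3 := hin (k - a + i) (by omega) (by omega)
    have h4 := hUL _ h3
    rw [mem_closedNbhd] at h4
    push Not at h4
    exact ⟨fun e => h4.1 (e ▸ hqL j hj hj'), h4.2 _ (hqL j hj hj')⟩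
  · intro i hi
    by_cases hiU : p (k - a + i) ∈ U
    · exact hpY _ (by omega) hiU
    · refine hNY _ (by omega) hiU ?_
      rcases Nat.eq_zero_or_pos i with rfl | hi0
      · exact haN
      · rcases hi.lt_or_eq with h | rfl
        · exact absurd (hin _ (by omega) (by omega)) hiU
        · rwa [show k - a + (a + b) = k + b by omega]
  · intro j hj
    rcases Nat.eq_zero_or_pos j with rfl | hj0
    · rw [q0]; exact hNY _ (by omega) ha2 haN
    · rcases hj.lt_or_eq with h | rfl
      · exact hLY (hqL j hj0 h)
      · rw [ql]; exact hNY _ (by omega) hb2 hbN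

/-- The sets `W1`, `W2` are witness sets for the edge `ab`. -/
structure EdgeWitness {V : Type u} (G : SimpleGraph V) (a b : V) (W1 W2 : Set V) : Prop where
  adj : G.Adj a b
  chordal_left : ChordalSet G W1
  chordal_right : ChordalSet G W2
  inter : W1 ∩ W2 = {a, b}
  union : W1 ∪ W2 = ClosedNbhd G {a, b}
  not_extends : ¬ ExtendsToCover G {a, b} W1 W2

theorem EdgeWitness.swap {a b : V} {W1 W2 : Set V} (h : EdgeWitness G a b W1 W2) :
    EdgeWitness G b a W1 W2 :=
  ⟨h.adj.symm, h.chordal_left, h.chordal_right, Set.pair_comm a b ▸ h.inter,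
    Set.pair_comm a b ▸ h.union, Set.pair_comm a b ▸ h.not_extends⟩

theorem setOf_mem_pair (a b : V) : {v | v ∈ [a, b]} = ({a, b} : Set V) := by
  ext; simp

theorem gluing_lemma (hmin : ∀ S : Set V, S ≠ Set.univ → WeaklyFPE (G.induce S)) {a b : V}
    {W1 W2 : Set V} (hw : EdgeWitness G a b W1 W2) {l : List V} (hl : IsInducedPathList G l)
    (hl2 : l.length ≤ 2) {L N U : Set V} (hlL : {v | v ∈ l} = L) (hL : G.IsClique L)
    (hNdef : N = ClosedNbhd G L \ ({a, b} \ L)) (hU : U.Nonempty)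
    (hUL : ∀ u ∈ U, u ∉ ClosedNbhd G L) (hUP : ∀ u ∈ U, u ∉ ClosedNbhd G {a, b})
    (hUN : ∀ u ∈ U, ∀ y, G.Adj u y → y ∈ U ∨ y ∈ ClosedNbhd G L) (hne : ∃ z, z ∉ U ∧ z ∉ N)
    (hch : ∀ X, ChordalSet G X → a ∈ X → b ∈ X → ChordalSet G (X ∩ N ∪ L)) : False := by
  have hLcl : L ⊆ ClosedNbhd G L := fun x hx => Or.inl hx
  have hPcl : {a, b} ⊆ ClosedNbhd G {a, b} := fun x hx => Or.inl hx
  have hLN : L ⊆ N := fun x hx => hNdef ▸ ⟨hLcl hx, fun h => h.2 hx⟩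
  have hUN' : ∀ u ∈ U, ∀ y, G.Adj u y → y ∈ U ∨ y ∈ N := by
    intro u hu y huy
    refine (hUN u hu y huy).imp_right fun hy => hNdef ▸ ⟨hy, fun h => hUP u hu ?_⟩
    exact Or.inr ⟨y, h.1, huy⟩
  have hNU : ∀ u ∈ U, u ∉ N := fun u hu h => hUL u hu (hNdef ▸ h : _).1
  have hW : ∀ W, W ⊆ W1 ∪ W2 → W ⊆ Uᶜ := fun W hW x hx hxU =>
    hUP x hxU (hw.union ▸ hW hx)
  have hUne : (Uᶜ : Set V) ≠ Set.univ := by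
    obtain ⟨u, hu⟩ := hU
    exact fun h => (h ▸ Set.mem_univ u : u ∈ Uᶜ) hu
  obtain ⟨X1, X2, hWX1, hWX2, hX1, hX2, hXI, hXU⟩ := exists_extension (hmin _ hUne)
    (isInducedPathList_pair hw.adj) (by simp)
    (fun v hv hvU => hUP v hvU (Or.inl (setOf_mem_pair a b ▸ hv)))
    (hW W1 Set.subset_union_left) (hW W2 Set.subset_union_right)
    hw.chordal_left hw.chordal_right (by rw [setOf_mem_pair, hw.inter]) (by
      rw [setOf_mem_pair, hw.union, eq_comm, Set.inter_eq_left, ← hw.union]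
      exact hW _ le_rfl)
  rw [setOf_mem_pair] at hXI
  have haX : ∀ x ∈ ({a, b} : Set V), x ∈ X1 ∧ x ∈ X2 := fun x hx => by rwa [← hXI] at hx
  have hSne : U ∪ N ≠ Set.univ := by
    obtain ⟨z, hz1, hz2⟩ := hne
    exact fun h => (h ▸ Set.mem_univ z : z ∈ U ∪ N).elim hz1 hz2
  have hPN : {a, b} ∩ N ⊆ L := fun x hx => by
    by_contra hxL
    exact (hNdef ▸ hx.2 : _).2 ⟨hx.1, hxL⟩
  have hXmem : ∀ x, x ∉ U → x ∈ X1 ∨ x ∈ X2 := fun x hx => by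
    have : x ∈ X1 ∪ X2 := hXU ▸ hx
    exact this
  have hXnot : ∀ x ∈ U, x ∉ X1 ∧ x ∉ X2 := fun x hx => by
    have : x ∉ X1 ∪ X2 := fun h => (hXU ▸ h : x ∈ Uᶜ) hx
    exact ⟨fun h => this (Or.inl h), fun h => this (Or.inr h)⟩
  obtain ⟨Y1, Y2, hWY1, hWY2, hY1, hY2, hYI, hYU⟩ := exists_extension (hmin _ hSne) hl hl2
    (W1 := X1 ∩ N ∪ L) (W2 := X2 ∩ N ∪ L) (fun v hv => Or.inr (hLN (hlL ▸ hv)))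
    (Set.union_subset (fun x hx => Or.inr hx.2) fun x hx => Or.inr (hLN hx))
    (Set.union_subset (fun x hx => Or.inr hx.2) fun x hx => Or.inr (hLN hx))
    (hch X1 hX1 (haX a (by simp)).1 (haX b (by simp)).1)
    (hch X2 hX2 (haX a (by simp)).2 (haX b (by simp)).2) (by
      rw [hlL]
      ext x
      constructor
      · rintro ⟨h1 | h1, h2 | h2⟩
        · exact hPN ⟨hXI ▸ ⟨h1.1, h2.1⟩, h1.2⟩
        all_goals assumption
      · exact fun h => ⟨Or.inr h, Or.inr h⟩) (by
      rw [hlL]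
      ext x
      constructor
      · rintro ((h | h) | (h | h))
        · exact ⟨(hNdef ▸ h.2 : _).1, Or.inr h.2⟩
        · exact ⟨hLcl h, Or.inr (hLN h)⟩
        · exact ⟨(hNdef ▸ h.2 : _).1, Or.inr h.2⟩
        · exact ⟨hLcl h, Or.inr (hLN h)⟩
      · rintro ⟨h1, h2 | h2⟩
        · exact absurd h1 (hUL x h2)
        · rcases hXmem x (fun h => hNU x h h2) with h | h
          · exact Or.inl (Or.inl ⟨h, h2⟩)
          · exact Or.inr (Or.inl ⟨h, h2⟩))
  rw [hlL] at hYI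
  have hLY : ∀ x ∈ L, x ∈ Y1 ∧ x ∈ Y2 := fun x hx => by rwa [← hYI] at hx
  refine hw.not_extends ⟨X1 ∪ Y1 ∩ U, X2 ∪ Y2 ∩ U, hWX1.trans Set.subset_union_left,
    hWX2.trans Set.subset_union_left, ?_, ?_, ?_, ?_⟩
  · exact hX1.glue hY1 hL (hNdef ▸ Set.sdiff_subset) hUL hUN' (fun u hu => (hXnot u hu).1)
      (Set.subset_union_left.trans hWY1) (fun x hx => (hLY x hx).1)
  · exact hX2.glue hY2 hL (hNdef ▸ Set.sdiff_subset) hUL hUN' (fun u hu => (hXnot u hu).2)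
      (Set.subset_union_left.trans hWY2) (fun x hx => (hLY x hx).2)
  · rw [← hXI]
    ext x
    constructor
    · rintro ⟨h1 | h1, h2 | h2⟩
      · exact ⟨h1, h2⟩
      · exact absurd h1 (hXnot x h2.2).1
      · exact absurd h2 (hXnot x h1.2).2
      · exact absurd (hLcl (hYI ▸ ⟨h1.1, h2.1⟩)) (hUL x h1.2)
    · exact fun h => ⟨Or.inl h.1, Or.inl h.2⟩
  · rw [Set.eq_univ_iff_forall]
    intro x
    by_cases hx : x ∈ U
    · have : x ∈ Y1 ∪ Y2 := hYU ▸ Or.inl hx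
      exact this.imp (fun h => Or.inr ⟨h, hx⟩) (fun h => Or.inr ⟨h, hx⟩)
    · exact (hXmem x hx).imp Or.inl Or.inl

end Witness

/-! ### Local structure at a witness edge -/

section LocalStructure

variable {V : Type u} {G : SimpleGraph V}

theorem deletion_lemma (hmin : ∀ S : Set V, S ≠ Set.univ → WeaklyFPE (G.induce S)) {a b x : V}
    {W1 W2 : Set V} (hw : EdgeWitness G a b W1 W2) {l : List V} (hl : IsInducedPathList G l)
    (hl2 : l.length ≤ 2) (hlP : {v | v ∈ l} = ({a, b} : Set V) \ {x})
    (hN : ClosedNbhd G {a, b} \ {x} ⊆ ClosedNbhd G ({a, b} \ {x}))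
    (hx : x ∈ ClosedNbhd G {a, b}) :
    ∃ W X H : Set V, ChordalSet G W ∧ ChordalSet G X ∧ ({a, b} : Set V) \ {x} ⊆ X ∧
      x ∈ W ∧ X ∩ ClosedNbhd G {a, b} ⊆ W ∧ IsHole G H ∧ x ∈ H ∧ H ⊆ insert x X := by
  have hS : ({x}ᶜ : Set V) ≠ Set.univ := by
    rw [Ne, Set.eq_univ_iff_forall]
    exact fun h => h x rfl
  obtain ⟨X1, X2, h1, h2, hX1, hX2, hXI, hXU⟩ := exists_extension (hmin _ hS) hl hl2
    (W1 := W1 \ {x}) (W2 := W2 \ {x}) (fun v hv => (hlP ▸ hv : v ∈ ({a, b} : Set V) \ {x}).2)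
    (fun v hv => hv.2) (fun v hv => hv.2)
    (hw.chordal_left.mono Set.sdiff_subset) (hw.chordal_right.mono Set.sdiff_subset)
    (by
      rw [hlP, ← hw.inter]
      ext y
      simp only [Set.mem_inter_iff, Set.mem_sdiff]
      tauto)
    (by
      rw [← Set.union_sdiff_distrib, hw.union, hlP]
      refine subset_antisymm (fun y hy => ⟨hN hy, hy.2⟩) ?_
      rintro y ⟨hy | ⟨s, hs, hy⟩, hyx⟩
      · exact ⟨Or.inl hy.1, hyx⟩
      · exact ⟨Or.inr ⟨s, hs.1, hy⟩, hyx⟩)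
  rw [hlP] at hXI
  have side : ∀ W W' X X' : Set V, ChordalSet G W → ChordalSet G X → W ∩ W' = {a, b} →
      W ∪ W' = ClosedNbhd G {a, b} → W' \ {x} ⊆ X' → X ∩ X' = {a, b} \ {x} →
      X ∪ X' = {x}ᶜ → ¬ ChordalSet G (X ∪ W ∩ {x}) → ∃ W X H : Set V, ChordalSet G W ∧
      ChordalSet G X ∧ ({a, b} : Set V) \ {x} ⊆ X ∧ x ∈ W ∧ X ∩ ClosedNbhd G {a, b} ⊆ W ∧
      IsHole G H ∧ x ∈ H ∧ H ⊆ insert x X := by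
    intro W W' X X' hW hX hI hU hW' hXI hXU hch
    unfold ChordalSet at hch
    push Not at hch
    obtain ⟨H, hHX, hH⟩ := hch
    have hxHW : x ∈ H ∧ x ∈ W := by
      by_contra hcon
      refine hX H (fun y hy => ?_) hH
      rcases hHX hy with h | ⟨h, rfl⟩
      · exact h
      · exact absurd ⟨hy, h⟩ hcon
    refine ⟨W, X, H, hW, hX, ?_, hxHW.2, ?_, hH, hxHW.1, fun y hy => ?_⟩
    · rw [← hXI]; exact Set.inter_subset_left
    · rintro y ⟨hyX, hyN⟩
      have hyx : y ∉ ({x} : Set V) := by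
        have : y ∈ X ∪ X' := Or.inl hyX
        rwa [hXU] at this
      rw [← hU] at hyN
      rcases hyN with h | h
      · exact h
      · have : y ∈ X ∩ X' := ⟨hyX, hW' ⟨h, hyx⟩⟩
        rw [hXI] at this
        rw [← hI] at this
        exact this.1.1
    · exact (hHX hy).elim Or.inr fun h => Or.inl h.2
  by_contra hcon
  have c1 : ChordalSet G (X1 ∪ W1 ∩ {x}) := by
    by_contra h
    exact hcon (side W1 W2 X1 X2 hw.chordal_left hX1 hw.inter hw.union h2 hXI hXU h)
  have c2 : ChordalSet G (X2 ∪ W2 ∩ {x}) := by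
    by_contra h
    exact hcon (side W2 W1 X2 X1 hw.chordal_right hX2 (by rw [Set.inter_comm, hw.inter])
      (by rw [Set.union_comm, hw.union]) h1 (by rw [Set.inter_comm, hXI])
      (by rw [Set.union_comm, hXU]) h)
  have hX : ∀ y, y ∈ X1 ∨ y ∈ X2 ↔ y ≠ x := fun y => by
    rw [← Set.mem_union, hXU]; rfl
  refine hw.not_extends ⟨_, _, fun y hy => ?_, fun y hy => ?_, c1, c2, ?_, ?_⟩
  · by_cases h : y = x
    · exact Or.inr ⟨hy, h⟩
    · exact Or.inl (h1 ⟨hy, h⟩)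
  · by_cases h : y = x
    · exact Or.inr ⟨hy, h⟩
    · exact Or.inl (h2 ⟨hy, h⟩)
  · rw [← hw.inter] at hXI ⊢
    ext y
    have e1 : y ∈ X1 ∧ y ∈ X2 ↔ (y ∈ W1 ∧ y ∈ W2) ∧ y ≠ x := Set.ext_iff.1 hXI y
    have e2 := hX y
    simp only [Set.mem_inter_iff, Set.mem_union, Set.mem_singleton_iff]
    tauto
  · rw [Set.eq_univ_iff_forall]
    intro y
    have e2 := hX y
    by_cases hyx : y = x
    · rw [← hyx] at hx
      rw [← hw.union] at hx
      exact hx.imp (fun h => Or.inr ⟨h, hyx⟩) (fun h => Or.inr ⟨h, hyx⟩)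
    · exact (e2.2 hyx).imp Or.inl Or.inl

/-- The set of vertices different from and nonadjacent to `v`. -/
def antiNbhd {V : Type u} (G : SimpleGraph V) (v : V) : Set V :=
  {z | z ≠ v ∧ ¬ G.Adj v z}

theorem closedNbhd_pair_iff {a b x : V} :
    x ∈ ClosedNbhd G {a, b} ↔ (x = a ∨ G.Adj a x) ∨ (x = b ∨ G.Adj b x) := by
  simp only [mem_closedNbhd, Set.mem_insert_iff, Set.mem_singleton_iff, exists_eq_or_imp,
    exists_eq_left, G.adj_comm x]
  tauto

theorem not_mem_closedNbhd_pair {a b x : V} :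
    x ∉ ClosedNbhd G {a, b} ↔ x ∈ antiNbhd G a ∧ x ∈ antiNbhd G b := by
  rw [closedNbhd_pair_iff]
  simp only [antiNbhd, Set.mem_ofPred_eq]
  tauto

theorem not_mem_antiNbhd {v x : V} : x ∉ antiNbhd G v ↔ x = v ∨ G.Adj v x := by
  simp only [antiNbhd, Set.mem_ofPred_eq]
  tauto

/-- No vertex is adjacent to all others. -/
theorem EdgeWitness.antiNbhd_nonempty (hmin : ∀ S : Set V, S ≠ Set.univ → WeaklyFPE (G.induce S))
    {a b : V} {W1 W2 : Set V} (hw : EdgeWitness G a b W1 W2) (v : V) :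
    (antiNbhd G v).Nonempty := by
  by_contra hcon
  rw [Set.not_nonempty_iff_eq_empty, Set.eq_empty_iff_forall_notMem] at hcon
  simp only [not_mem_antiNbhd] at hcon
  by_cases hv : v ∈ ({a, b} : Set V)
  · have : W1 ∪ W2 = Set.univ := by
      rw [hw.union, Set.eq_univ_iff_forall]
      exact fun y => (hcon y).elim (fun h => Or.inl (h ▸ hv)) fun h => Or.inr ⟨v, hv, h.symm⟩
    exact hw.not_extends ⟨W1, W2, le_rfl, le_rfl, hw.chordal_left, hw.chordal_right, hw.inter, this⟩
  · have e : ({a, b} : Set V) \ {v} = {a, b} := Set.sdiff_singleton_eq_self hv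
    obtain ⟨-, -, H, -, -, -, -, -, hH, hvH, -⟩ := deletion_lemma (x := v) hmin hw
      (isInducedPathList_pair hw.adj) (by simp) (by rw [setOf_mem_pair, e])
      (by rw [e]; exact Set.sdiff_subset)
      (Or.inr ⟨a, by simp, ((hcon a).resolve_left fun h => hv (h ▸ by simp))⟩)
    obtain ⟨y, -, hy, hy'⟩ := hH.not_complete hvH
    exact hy' ((hcon y).resolve_left hy)

/-- No neighbor of an end of the witness edge is dominated by that end. -/
theorem EdgeWitness.domination (hmin : ∀ S : Set V, S ≠ Set.univ → WeaklyFPE (G.induce S))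
    {a b : V} {W1 W2 : Set V} (hw : EdgeWitness G a b W1 W2) {x : V} (hax : G.Adj a x) :
    ∃ y ∈ antiNbhd G a, G.Adj x y := by
  by_contra! hcon
  have hdom : ∀ y, G.Adj x y → y = a ∨ G.Adj a y := fun y hy =>
    not_mem_antiNbhd.1 fun h => hcon y h hy
  have key : ∃ W X H : Set V, ChordalSet G W ∧ ChordalSet G X ∧ ({a, b} : Set V) \ {x} ⊆ X ∧
      x ∈ W ∧ X ∩ ClosedNbhd G {a, b} ⊆ W ∧ IsHole G H ∧ x ∈ H ∧ H ⊆ insert x X := by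
    by_cases hxb : x = b
    · subst hxb
      have e : ({a, x} : Set V) \ {x} = {a} := by
        ext y
        simp only [Set.mem_sdiff, Set.mem_insert_iff, Set.mem_singleton_iff]
        refine ⟨by tauto, ?_⟩
        rintro rfl
        exact ⟨Or.inl rfl, hax.ne⟩
      refine deletion_lemma (l := [a]) hmin hw isInducedPathList_singleton (by simp)
        (by rw [e]; ext; simp) ?_ (Or.inl (by simp))
      rw [e]
      rintro y ⟨hy, hyx⟩
      rw [closedNbhd_pair_iff] at hy
      have : y = a ∨ G.Adj a y := by
        rcases hy with h | h | h
        exacts [h, absurd h hyx, hdom y h]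
      exact this.elim Or.inl fun h => Or.inr ⟨a, rfl, h.symm⟩
    · have e : ({a, b} : Set V) \ {x} = {a, b} := Set.sdiff_singleton_eq_self (by
        rintro (h | h)
        exacts [hax.ne' h, hxb h])
      exact deletion_lemma hmin hw (isInducedPathList_pair hw.adj) (by simp)
        (by rw [setOf_mem_pair, e]) (by rw [e]; exact Set.sdiff_subset)
        (Or.inr ⟨a, by simp, hax.symm⟩)
  obtain ⟨W, X, H, hW, hX, hPX, hxW, hXW, ⟨n, hn⟩, hxH, hHX⟩ := key
  obtain ⟨p, hp, hpH, hpy, hpx⟩ := hn.open_at hxH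
  have hn4 := hn.1
  have hpX : ∀ i ≤ n - 2, p i ∈ X := fun i hi => (hHX (hpH i hi).1).resolve_left (hpH i hi).2
  have h0 := hdom _ ((hpx 0 (by omega)).2 (Or.inl rfl))
  have hm := hdom _ ((hpx (n - 2) le_rfl).2 (Or.inr rfl))
  have hpa : ∀ i ≤ n - 2, p i ≠ a := by
    intro i hi e
    have h1 := (hpx i hi).1 (e ▸ hax.symm)
    rcases h1 with rfl | rfl
    · rcases hm with h | h
      · have := hp.1 _ hi _ le_rfl (e.trans h.symm)
        omega
      · rw [← e, hp.2 _ hi _ le_rfl] at h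
        omega
    · rcases h0 with h | h
      · have := hp.1 _ hi 0 (by omega) (e.trans h.symm)
        omega
      · rw [← e, hp.2 _ hi 0 (by omega)] at h
        omega
  have hall := hp.adj_of_chordal hX (h0.resolve_left (hpa 0 (by omega)))
    (hm.resolve_left (hpa _ le_rfl)) hpX (hPX ⟨by simp, hax.ne⟩) hpa
  refine hW H (fun y hy => ?_) ⟨n, hn⟩
  rcases hpy y hy with rfl | ⟨i, hi, rfl⟩
  · exact hxW
  · exact hXW ⟨hpX i hi, Or.inr ⟨a, by simp, (hall i hi).symm⟩⟩

/-- Every vertex outside the closed neighborhood of some `c` adjacent to `a` is within distance one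
of a vertex outside both closed neighborhoods. -/
theorem EdgeWitness.exists_far (hmin : ∀ S : Set V, S ≠ Set.univ → WeaklyFPE (G.induce S))
    (hE : EvenHoleFree G) {a b c y : V} {W1 W2 : Set V} (hw : EdgeWitness G a b W1 W2)
    (hac : G.Adj a c) (hy : y ∈ antiNbhd G c) :
    ∃ z, (z = y ∨ G.Adj y z) ∧ z ∈ antiNbhd G c ∧ z ∈ antiNbhd G a := by
  by_cases hya : y ∈ antiNbhd G a
  · exact ⟨y, Or.inl rfl, hy, hya⟩
  rw [not_mem_antiNbhd] at hya
  rcases hya with rfl | hya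
  · exact absurd hac.symm hy.2
  obtain ⟨z, hza, hyz⟩ := hw.domination hmin hya
  refine ⟨z, Or.inr hyz, ?_, hza⟩
  by_contra hzc
  rw [not_mem_antiNbhd] at hzc
  rcases hzc with rfl | hzc
  · exact hza.2 hac
  · exact hE.no_square hac.symm hya hyz hzc.symm hy.2 hza.2 hy.1.symm hza.1.symm

/-- The vertices outside the closed neighborhood of `a` induce a connected subgraph. -/
theorem EdgeWitness.reachIn_antiNbhd (hmin : ∀ S : Set V, S ≠ Set.univ → WeaklyFPE (G.induce S))
    (hE : EvenHoleFree G) {a b : V} {W1 W2 : Set V} (hw : EdgeWitness G a b W1 W2) {x y : V}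
    (hx : x ∈ antiNbhd G a) (hy : y ∈ antiNbhd G a) : ReachIn G (antiNbhd G a) x y := by
  by_contra hxy
  obtain ⟨z, hzx, hza, hzb⟩ := hw.swap.exists_far hmin hE hw.adj.symm hx
  obtain ⟨u, huy, hua, hub⟩ := hw.swap.exists_far hmin hE hw.adj.symm hy
  have hxz : ReachIn G (antiNbhd G a) x z := by
    rcases hzx with rfl | h
    exacts [.refl, .single ⟨h, hza⟩]
  have hxu : ¬ ReachIn G (antiNbhd G a) x u := by
    rcases huy with rfl | h
    exacts [hxy, fun h' => hxy (.tail h' ⟨h.symm, hy⟩)]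
  refine gluing_lemma hmin hw (isInducedPathList_pair hw.adj) (by simp) (setOf_mem_pair a b)
    (N := ClosedNbhd G {a, b})
    (U := {u | u ∉ ClosedNbhd G {a, b} ∧ ¬ ReachIn G (antiNbhd G a) x u}) ?_ (by simp)
    ⟨u, not_mem_closedNbhd_pair.2 ⟨hua, hub⟩, hxu⟩ (fun u hu => hu.1) (fun u hu => hu.1) ?_
    ⟨z, fun h => h.2 hxz, not_mem_closedNbhd_pair.2 ⟨hza, hzb⟩⟩ ?_
  · exact SimpleGraph.isClique_pair.2 fun _ => hw.adj
  · intro u hu y huy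
    by_contra hcon
    push Not at hcon
    exact hcon.1 ⟨hcon.2, fun h => hu.2 (.tail h ⟨huy.symm, (not_mem_closedNbhd_pair.1 hu.1).1⟩)⟩
  · intro X hX haX hbX
    refine hX.mono (Set.union_subset Set.inter_subset_left ?_)
    rintro _ (rfl | rfl)
    exacts [haX, hbX]

end LocalStructure

section CompleteHole

variable {V : Type u} {G : SimpleGraph V}

/-- A twin wheel from a path `f` closed by a vertex `a`, and a vertex `y` whose only neighbors on
the resulting hole are `a`, `f 0` and `f 1`. -/
theorem isTwinWheel_of_path {n : ℕ} {f : ℕ → V} (hf : IndPath G n f) (hn : 2 ≤ n) {a y : V}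
    (h0 : G.Adj a (f 0)) (hn' : G.Adj a (f n)) (ha : ∀ i, 0 < i → i < n → f i ∈ antiNbhd G a)
    (hya : G.Adj y a) (hy0 : G.Adj y (f 0)) (hy1 : G.Adj y (f 1))
    (hy : ∀ i, 2 ≤ i → i ≤ n → f i ∈ antiNbhd G y) : ∃ H, IsTwinWheel G H y := by
  obtain ⟨g, hg, g0, g1, g2⟩ := indPath_two h0.symm hn' (fun e => by
    have := hf.1 _ (by omega) _ (by omega) e
    omega) (by rw [hf.2 _ (by omega) _ (by omega)]; omega)
  have hole := isHoleOn_of_paths hf hg g0.symm g2.symm hn le_rfl (by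
    intro i hi hi' j hj hj'
    obtain rfl : j = 1 := by omega
    rw [g1]
    exact ⟨(ha i hi hi').1, fun h => (ha i hi hi').2 h.symm⟩)
  have ha1 := ha 1 (by omega) (by omega)
  have hmem : ∀ z, z ∈ f '' {i | i ≤ n} ∪ g '' {j | j ≤ 2} ↔ z = a ∨ ∃ i ≤ n, f i = z := by
    intro z
    constructor
    · rintro (⟨i, hi, rfl⟩ | ⟨j, hj, rfl⟩)
      · exact Or.inr ⟨i, hi, rfl⟩
      · have hj : j ≤ 2 := hj
        interval_cases j
        · exact Or.inr ⟨0, by omega, g0.symm⟩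
        · exact Or.inl g1
        · exact Or.inr ⟨n, le_rfl, g2.symm⟩
    · rintro (rfl | ⟨i, hi, rfl⟩)
      · exact Or.inr ⟨1, by simp, g1⟩
      · exact Or.inl ⟨i, hi, rfl⟩
  have hN : (f '' {i | i ≤ n} ∪ g '' {j | j ≤ 2}) ∩ {u | G.Adj y u} = {a, f 0, f 1} := by
    ext z
    rw [Set.mem_inter_iff, hmem]
    constructor
    · rintro ⟨rfl | ⟨i, hi, rfl⟩, hz⟩
      · exact Or.inl rfl
      · have : i < 2 := by
          by_contra h
          exact (hy i (by omega) hi).2 hz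
        interval_cases i <;> simp
    · rintro (rfl | rfl | rfl)
      · exact ⟨Or.inl rfl, hya⟩
      · exact ⟨Or.inr ⟨0, by omega, rfl⟩, hy0⟩
      · exact ⟨Or.inr ⟨1, by omega, rfl⟩, hy1⟩
  have h01 := hf.adj_succ (i := 0) (by omega)
  refine ⟨_, ⟨⟨_, hole⟩, ?_, ?_⟩, a, f 0, f 1, h0.ne, h01.ne, ha1.1.symm, hN, h0, h01, ha1.2⟩
  · rw [hmem]
    rintro (rfl | ⟨i, hi, rfl⟩)
    · exact G.loopless.irrefl _ hya
    · have : i < 2 := by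
        by_contra h
        exact (hy i (by omega) hi).1 rfl
      interval_cases i
      · exact G.loopless.irrefl _ hy0
      · exact G.loopless.irrefl _ hy1
  · rw [hN, Set.ncard_eq_three.2 ⟨a, f 0, f 1, h0.ne, ha1.1.symm, h01.ne, rfl⟩]

/-- No hole is complete to an end of the witness edge. -/
theorem EdgeWitness.not_complete_hole
    (hmin : ∀ S : Set V, S ≠ Set.univ → WeaklyFPE (G.induce S)) (hE : EvenHoleFree G)
    (hT : ∀ (H : Set V) (v : V), ¬ IsTwinWheel G H v) {a b : V} {W1 W2 : Set V}
    (hw : EdgeWitness G a b W1 W2) {H : Set V} (hH : IsHole G H) (haH : ∀ h ∈ H, G.Adj a h) :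
    False := by
  let Q : ℕ → Prop := fun n => ∃ h ∈ H, ∃ h' ∈ H, h ≠ h' ∧ ¬ G.Adj h h' ∧ ∃ f : ℕ → V,
    f 0 = h ∧ f n = h' ∧ (∀ i < n, G.Adj (f i) (f (i + 1))) ∧
    ∀ i, 0 < i → i < n → f i ∈ antiNbhd G a
  have hexQ : ∃ n, Q n := by
    obtain ⟨N, hN⟩ := hH
    obtain ⟨h, hh⟩ : H.Nonempty := by
      obtain ⟨_, f, -, rfl, -⟩ := hN
      exact ⟨_, 0, rfl⟩
    obtain ⟨h', hh', hne, hadj⟩ := IsHole.not_complete ⟨N, hN⟩ hh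
    obtain ⟨y, hy, hhy⟩ := hw.domination hmin (haH h hh)
    obtain ⟨y', hy', hhy'⟩ := hw.domination hmin (haH h' hh')
    obtain ⟨n, f, hf, f0, fn, hfS⟩ := ReachIn.exists_indPath
      ((hw.reachIn_antiNbhd hmin hE hy hy').head hhy hy) hhy'.symm
    exact ⟨n, h, hh, h', hh', hne.symm, hadj, f, f0, fn, fun i hi => hf.adj_succ hi, hfS⟩
  have hQ := Nat.find_spec hexQ
  have hQmin := fun k hk => Nat.find_min hexQ (m := k) hk
  generalize Nat.find hexQ = n at hQ hQmin
  obtain ⟨h, hh, h', hh', hne, hadj, f', f0', fn', hf', hfS'⟩ := hQ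
  obtain ⟨m, hmn, f, hf, f0, fm, hfS⟩ := exists_indPath_of_walk n f' hf' hfS'
  rw [f0'] at f0
  rw [fn'] at fm
  obtain rfl : m = n := by
    by_contra hcon
    exact hQmin m (by omega) ⟨h, hh, h', hh', hne, hadj, f, f0, fm, fun i hi => hf.adj_succ hi, hfS⟩
  clear hf' hfS' f0' fn' f' hmn
  have hn2 : 2 ≤ m := by
    by_contra hcon
    obtain rfl | rfl : m = 0 ∨ m = 1 := by omega
    · exact hne (f0.symm.trans fm)
    · exact hadj (by rw [← f0, ← fm]; exact hf.adj_succ (by omega))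
  have hodd : Odd m := by
    obtain ⟨g, hg, g0, g1, g2⟩ := indPath_two (haH h hh).symm (haH h' hh') hne hadj
    have := hE.odd_paths hf hg (by rw [f0, g0]) (by rw [fm, g2]) hn2 le_rfl (by
      intro i hi hi' j hj hj'
      obtain rfl : j = 1 := by omega
      rw [g1]
      exact ⟨(hfS i hi hi').1, fun h => (hfS i hi hi').2 h.symm⟩)
    rw [Nat.odd_add] at this
    exact this.2 (by decide)
  have hn3 : 3 ≤ m := by
    obtain ⟨k, hk⟩ := hodd
    omega
  -- a vertex of the hole with a neighbor early on the path is adjacent to the start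
  have hleft : ∀ (f : ℕ → V), IndPath G m f → f 0 ∈ H →
      (∀ i, 0 < i → i < m → f i ∈ antiNbhd G a) → ∀ y ∈ H, y ≠ f 0 → ∀ i, 0 < i → i + 2 ≤ m →
      G.Adj y (f i) → G.Adj (f 0) y := by
    intro f hf h0 hfS y hyH hy0 i hi him hyi
    by_contra hcon
    refine hQmin (i + 1) (by omega) ⟨f 0, h0, y, hyH, hy0.symm, hcon,
      fun j => if j ≤ i then f j else y, by simp, by simp, ?_, ?_⟩
    · intro j hj
      dsimp only
      rcases Nat.lt_or_ge j i with h | h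
      · rw [if_pos h.le, if_pos (by omega)]; exact hf.adj_succ (by omega)
      · obtain rfl : j = i := by omega
        rw [if_pos le_rfl, if_neg (by omega)]; exact hyi.symm
    · intro j hj hj'
      dsimp only
      rw [if_pos (by omega)]
      exact hfS j hj (by omega)
  have hrevS : ∀ (f : ℕ → V), (∀ i, 0 < i → i < m → f i ∈ antiNbhd G a) →
      ∀ i, 0 < i → i < m → f (m - i) ∈ antiNbhd G a := fun f hfS i hi hi' =>
    hfS _ (by omega) (by omega)
  have hone : ∀ (f : ℕ → V), IndPath G m f → f 0 ∈ H → f m ∈ H →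
      (∀ i, 0 < i → i < m → f i ∈ antiNbhd G a) → ∀ y ∈ H, y ≠ f 0 → y ≠ f m →
      ∀ i, 0 < i → i < m → G.Adj y (f i) → G.Adj (f m) y := by
    intro f hf h0 hm hfS y hyH hy0 hym i hi him hyi
    have hlate : ∀ i, 2 ≤ i → i < m → G.Adj y (f i) → G.Adj (f m) y := by
      intro i hi him hyi
      have := hleft _ hf.reverse (by simpa using hm) (hrevS f hfS) y hyH (by simpa using hym)
        (m - i) (by omega) (by omega) (by rwa [Nat.sub_sub_self him.le])
      simpa using this
    by_contra hcon
    obtain rfl : i = 1 := by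
      by_contra h1
      exact hcon (hlate i (by omega) him hyi)
    obtain ⟨H', hH'⟩ := isTwinWheel_of_path hf hn2 (haH _ h0) (haH _ hm) hfS (haH y hyH).symm
      (hleft f hf h0 hfS y hyH hy0 1 hi (by omega) hyi).symm hyi (by
        intro j hj hjm
        rcases hjm.lt_or_eq with hjm | rfl
        · exact ⟨fun e => (hfS j (by omega) hjm).2 (e ▸ haH y hyH),
            fun h => hcon (hlate j hj hjm h)⟩
        · exact ⟨hym.symm, fun h => hcon h.symm⟩)
    exact hT _ _ hH'
  have hboth : ∀ y ∈ H, y ≠ h → y ≠ h' → ∀ i, 0 < i → i < m → G.Adj y (f i) →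
      G.Adj h y ∧ G.Adj h' y := by
    intro y hyH hyh hyh' i hi him hyi
    subst f0 fm
    refine ⟨?_, hone f hf hh hh' hfS y hyH hyh hyh' i hi him hyi⟩
    have := hone _ hf.reverse (by simpa using hh') (by simpa using hh) (hrevS f hfS) y hyH
      (by simpa using hyh') (by simpa using hyh) (m - i) (by omega) (by omega)
      (by rwa [Nat.sub_sub_self him.le])
    simpa using this
  have hside : ∀ s q, IndPath G s q → q 0 = h → q s = h' → (∀ i ≤ s, q i ∈ H) → ¬ Odd s := by
    intro s q hq q0 qs hqH hs
    have hs3 : 3 ≤ s := by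
      obtain ⟨k, rfl⟩ := hs
      have : k ≠ 0 := by
        rintro rfl
        exact hadj (by rw [← q0, ← qs]; exact hq.adj_succ (by omega))
      omega
    have := hE.odd_paths hq hf (by rw [q0, f0]) (by rw [qs, fm]) (by omega) hn2 (by
      intro i hi his j hj hjm
      refine ⟨fun e => (hfS j hj hjm).2 (e ▸ haH _ (hqH i his.le)), fun hij => ?_⟩
      have := hboth (q i) (hqH i his.le) (fun e => by
        have := hq.1 _ his.le 0 (by omega) (e.trans q0.symm)
        omega) (fun e => by
        have := hq.1 _ his.le s le_rfl (e.trans qs.symm)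
        omega) j hj hjm hij
      rw [← q0, ← qs, hq.2 _ (by omega) _ his.le, hq.2 _ le_rfl _ his.le] at this
      omega)
    rw [Nat.odd_add'] at this
    exact Nat.not_even_iff_odd.2 hs (this.1 hodd)
  obtain ⟨N, hN⟩ := hH
  obtain ⟨p, hp, hpH, hpy, hph⟩ := hN.open_at hh
  have hN4 := hN.1
  obtain ⟨k, hk, hkh⟩ := (hpy h' hh').resolve_left hne.symm
  have hk0 : 0 < k ∧ k < N - 2 := by
    have := hph k hk
    rw [hkh] at this
    have : ¬ (k = 0 ∨ k = N - 2) := fun h => hadj (this.2 h)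
    omega
  have hpside : ∀ p : ℕ → V, IndPath G (N - 2) p → (∀ i ≤ N - 2, p i ∈ H ∧ p i ≠ h) →
      (∀ i ≤ N - 2, (G.Adj h (p i) ↔ i = 0 ∨ i = N - 2)) → ∀ k, k < N - 2 → p k = h' →
      ¬ Odd (k + 1) := by
    intro p hp hpH hph k hk hkh
    refine hside _ _ ((hp.shift (k := 0) (m := k) (by omega)).cons (z := h)
      (by rw [hph 0 (by omega)]; simp) ?_) rfl (by simpa using hkh) ?_
    · intro i hi hik
      rw [zero_add]
      refine ⟨((hpH i (by omega)).2).symm, ?_⟩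
      rw [hph i (by omega)]
      omega
    · intro i hi
      split_ifs
      · exact hh
      · exact (hpH _ (by omega)).1
  have h1 := hpside p hp hpH hph k hk0.2 hkh
  have h2 := hpside _ hp.reverse (fun i hi => hpH _ (by omega)) (fun i hi => by
    rw [hph _ (by omega)]; omega) (N - 2 - k) (by omega) (by rwa [Nat.sub_sub_self hk])
  refine hE _ _ hN ?_
  rw [Nat.not_odd_iff_even] at h1 h2
  have := h1.add h2
  rwa [show k + 1 + (N - 2 - k + 1) = N by omega] at this

end CompleteHole

/-! ### Full star cutsets -/

section StarCutset

variable {V : Type u} {G : SimpleGraph V}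

/-- Split a walk at the first vertex that it has in `T`. -/
theorem ReachIn.exists_first {S T : Set V} {x y : V} (h : ReachIn G S x y) (hx : x ∉ T)
    (hy : y ∈ T) : ∃ z t, ReachIn G (S \ T) x z ∧ G.Adj z t ∧ t ∈ S ∧ t ∈ T ∧ z ∉ T := by
  by_contra! hcon
  have : ReachIn G (S \ T) x y ∧ y ∉ T := by
    clear hy
    induction h with
    | refl => exact ⟨.refl, hx⟩
    | tail _ h2 ih =>
      have hT := fun ht => ih.2 (hcon _ _ ih.1 h2.1 h2.2 ht)
      exact ⟨.tail ih.1 ⟨h2.1, h2.2, hT⟩, hT⟩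
  exact this.2 hy

theorem IndPath.two_le {n : ℕ} {f : ℕ → V} (hf : IndPath G n f) (h : f n ∈ antiNbhd G (f 0)) :
    2 ≤ n := by
  by_contra hcon
  obtain rfl | rfl : n = 0 ∨ n = 1 := by omega
  · exact h.1 rfl
  · exact h.2 (hf.adj_succ (by omega))

/-- A path whose ends are complete and whose interior is anticomplete to a vertex has odd length. -/
theorem EvenHoleFree.odd_of_apex (hE : EvenHoleFree G) {n : ℕ} {f : ℕ → V} (hf : IndPath G n f)
    (hn : 2 ≤ n) {v : V} (h0 : G.Adj v (f 0)) (h1 : G.Adj v (f n))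
    (hS : ∀ i, 0 < i → i < n → f i ∈ antiNbhd G v) : Odd n := by
  obtain ⟨g, hg, g0, g1, g2⟩ := indPath_two h0.symm h1 (fun e => by
    have := hf.1 _ (by omega) _ (by omega) e
    omega) (by rw [hf.2 _ (by omega) _ (by omega)]; omega)
  have := hE.odd_paths hf hg g0.symm g2.symm hn le_rfl (by
    intro i hi hi' j hj hj'
    obtain rfl : j = 1 := by omega
    rw [g1]
    exact ⟨(hS i hi hi').1, fun h => (hS i hi hi').2 h.symm⟩)
  rw [Nat.odd_add] at this
  exact this.2 (by decide)

/-- In the graph without `N[v] ∪ N[a]`, where `v` is a neighbor of `a`, every component contains a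
neighbor of `b`. -/
theorem EdgeWitness.exists_reachIn_adj
    (hmin : ∀ S : Set V, S ≠ Set.univ → WeaklyFPE (G.induce S)) (hE : EvenHoleFree G)
    (hT : ∀ (H : Set V) (v : V), ¬ IsTwinWheel G H v) {a b : V} {W1 W2 : Set V}
    (hw : EdgeWitness G a b W1 W2) {v u : V} (hva : G.Adj v a) (hvb : v ≠ b)
    (huv : u ∈ antiNbhd G v) (hua : u ∈ antiNbhd G a) :
    ∃ d, ReachIn G (antiNbhd G v ∩ antiNbhd G a) u d ∧ G.Adj d b := by
  by_contra! hcon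
  have hmem : ∀ x, ReachIn G (antiNbhd G v ∩ antiNbhd G a) u x →
      x ∈ antiNbhd G v ∧ x ∈ antiNbhd G a := fun x hx => hx.mem ⟨huv, hua⟩
  have hNdef : ∀ x, x ∈ ClosedNbhd G {v, a} \ ({a, b} \ {v, a}) → x ∉ antiNbhd G v ∨
      x ∉ antiNbhd G a := by
    intro x hx
    by_contra! h
    exact not_mem_closedNbhd_pair.2 h hx.1
  refine gluing_lemma hmin hw (isInducedPathList_pair hva) (by simp) (setOf_mem_pair v a)
    (U := {x | ReachIn G (antiNbhd G v ∩ antiNbhd G a) u x})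
    (SimpleGraph.isClique_pair.2 fun _ => hva) rfl ⟨u, .refl⟩ ?_ ?_ ?_ ⟨b, ?_, ?_⟩ ?_
  · intro x hx
    exact not_mem_closedNbhd_pair.2 (hmem x hx)
  · intro x hx
    have hxa := (hmem x hx).2
    exact not_mem_closedNbhd_pair.2 ⟨hxa, fun e => hxa.2 (e ▸ hw.adj), fun h => hcon x hx h.symm⟩
  · intro x hx y hxy
    by_contra! h
    exact h.1 (.tail hx ⟨hxy, not_mem_closedNbhd_pair.1 h.2⟩)
  · intro h
    exact (hmem b h).2.2 hw.adj
  · refine fun h => h.2 ⟨by simp, ?_⟩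
    rintro (h | h)
    exacts [hvb h.symm, hw.adj.ne' h]
  · intro X hX haX _ H hH hole
    have hvH : v ∈ H := by
      by_contra hv
      refine hX H (fun y hy => ?_) hole
      rcases hH hy with h | rfl | rfl
      exacts [h.1, absurd hy hv, haX]
    obtain ⟨n, hn⟩ := hole
    obtain ⟨p, hp, hpH, hpy, hpv⟩ := hn.open_at hvH
    have hn4 := hn.1
    have hodd := Nat.not_even_iff_odd.1 (hE _ _ hn)
    have hn5 : 5 ≤ n := by
      obtain ⟨k, rfl⟩ := hodd
      omega
    have hin : ∀ i, 0 < i → i < n - 2 → G.Adj a (p i) := by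
      intro i hi hi'
      have hvi : ¬ G.Adj v (p i) := by rw [hpv i hi'.le]; omega
      have hne := (hpH i hi'.le).2
      rcases hH (hpH i hi'.le).1 with h | h | h
      · have := (hNdef _ h.2).resolve_left fun h => h ⟨hne, hvi⟩
        rcases not_mem_antiNbhd.1 this with h | h
        · exact absurd (h ▸ hva) hvi
        · exact h
      · exact absurd h hne
      · exact absurd (h ▸ hva) hvi
    have hpa : ∀ i ≤ n - 2, p i ≠ a := by
      intro i hi e
      rcases (hpv i hi).1 (e ▸ hva) with rfl | rfl
      · have := hin 2 (by omega) (by omega)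
        rw [← e, hp.2 _ hi _ (by omega)] at this
        omega
      · have := hin (n - 2 - 2) (by omega) (by omega)
        rw [← e, hp.2 _ hi _ (by omega)] at this
        omega
    have hv1 : ∀ i, 0 < i → i < n - 2 → ¬ G.Adj v (p i) := fun i hi hi' => by
      rw [hpv i hi'.le]; omega
    refine hw.not_complete_hole hmin hE hT ⟨n, hn⟩ fun y hy => ?_
    rcases hpy y hy with rfl | ⟨i, hi, rfl⟩
    · exact hva.symm
    by_cases hi0 : 0 < i ∧ i < n - 2
    · exact hin i hi0.1 hi0.2
    by_contra hai
    have hvi := (hpv i hi).2 (by omega)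
    obtain ⟨j, hj, hj', hij⟩ : ∃ j, 0 < j ∧ j < n - 2 ∧ G.Adj (p i) (p j) := by
      rcases Nat.eq_zero_or_pos i with rfl | h
      · exact ⟨1, by omega, by omega, hp.adj_succ (by omega)⟩
      · exact ⟨n - 3, by omega, by omega, by rw [hp.2 _ hi _ (by omega)]; omega⟩
    exact hE.no_square hvi hij (hin j hj hj').symm hva.symm (hv1 j hj hj') (fun h => hai h.symm)
      (hpH j hj'.le).2.symm (hpa i hi)

theorem EdgeWitness.reachIn_of_not_mem_closedNbhd
    (hmin : ∀ S : Set V, S ≠ Set.univ → WeaklyFPE (G.induce S)) {a b : V} {W1 W2 : Set V}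
    (hw : EdgeWitness G a b W1 W2) {v x : V} (hv : v ∉ ClosedNbhd G {a, b})
    (hx : x ∈ antiNbhd G v) : ReachIn G (antiNbhd G v) a x := by
  obtain ⟨hva, hvb⟩ := not_mem_closedNbhd_pair.1 hv
  have ha : a ∈ antiNbhd G v := ⟨hva.1.symm, fun h => hva.2 h.symm⟩
  have hb : b ∈ antiNbhd G v := ⟨hvb.1.symm, fun h => hvb.2 h.symm⟩
  by_contra hcon
  have hbr : ReachIn G (antiNbhd G v) a b := .single ⟨hw.adj, hb⟩
  refine gluing_lemma (L := {v}) hmin hw (isInducedPathList_singleton (a := v)) (by simp)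
    (by ext; simp) (U := {x | x ∈ antiNbhd G v ∧ ¬ ReachIn G (antiNbhd G v) a x})
    (SimpleGraph.isClique_singleton v) rfl ⟨x, hx, hcon⟩ ?_ ?_ ?_
    ⟨a, fun h => h.2 .refl, fun h => h.2 ⟨by simp, ha.1⟩⟩ ?_
  · rintro u hu (h | ⟨s, rfl, h⟩)
    exacts [hu.1.1 h, hu.1.2 h.symm]
  · rintro u hu h
    rcases closedNbhd_pair_iff.1 h with (rfl | h) | (rfl | h)
    exacts [hu.2 .refl, hu.2 (.single ⟨h, hu.1⟩), hu.2 hbr, hu.2 (.tail hbr ⟨h, hu.1⟩)]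
  · intro u hu y huy
    by_cases hy : y ∈ antiNbhd G v
    · exact Or.inl ⟨hy, fun h => hu.2 (.tail h ⟨huy.symm, hu.1⟩)⟩
    · exact Or.inr ((not_mem_antiNbhd.1 hy).imp id fun h => ⟨v, rfl, h.symm⟩)
  · intro X hX _ _ H hH hole
    by_cases hvH : v ∈ H
    · obtain ⟨y, hy, hyv, hadj⟩ := hole.not_complete hvH
      rcases hH hy with ⟨-, ⟨h | ⟨s, rfl, h⟩, -⟩⟩ | h
      exacts [hyv h, hadj h.symm, hyv h]
    · exact hX H (fun y hy => (hH hy).elim (fun h => h.1) fun h => absurd (h ▸ hy) hvH) hole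

/-- Two adjacent vertices `v` and `y` that see both ends of an induced path and nothing of its
interior give a twin wheel with center `y`. -/
theorem isTwinWheel_of_common_ends {n : ℕ} {f : ℕ → V} (hf : IndPath G n f) (hn : 2 ≤ n) {v y : V}
    (hv0 : G.Adj v (f 0)) (hvn : G.Adj v (f n)) (hv : ∀ i, 0 < i → i < n → f i ∈ antiNbhd G v)
    (hyv : G.Adj y v) (hy0 : G.Adj y (f 0)) (hyn : G.Adj y (f n))
    (hy : ∀ i, 0 < i → i < n → f i ∈ antiNbhd G y) : ∃ H, IsTwinWheel G H y := by
  have hg : IndPath G n (fun i => if i = 0 then v else f (i - 1)) := by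
    have := (hf.shift (k := 0) (m := n - 1) (by omega)).cons (z := v) (by simpa using hv0) (by
      intro i hi hi'
      rw [zero_add]
      exact ⟨(hv i hi (by omega)).1.symm, (hv i hi (by omega)).2⟩)
    rw [Nat.sub_add_cancel (by omega)] at this
    simpa using this
  refine isTwinWheel_of_path hg hn (a := f n) hvn.symm ?_ ?_ hyn hyv (by simpa using hy0) ?_
  · rw [if_neg (by omega), hf.2 _ le_rfl _ (by omega)]; omega
  · intro i hi hi'
    rw [if_neg (by omega)]
    refine ⟨fun e => ?_, by rw [hf.2 _ le_rfl _ (by omega)]; omega⟩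
    have := hf.1 _ (by omega) _ le_rfl e
    omega
  · intro i hi hi'
    rw [if_neg (by omega)]
    exact hy _ (by omega) (by omega)

theorem EdgeWitness.reachIn_of_adj_of_not_adj
    (hmin : ∀ S : Set V, S ≠ Set.univ → WeaklyFPE (G.induce S)) (hE : EvenHoleFree G)
    (hT : ∀ (H : Set V) (v : V), ¬ IsTwinWheel G H v) {a b : V} {W1 W2 : Set V}
    (hw : EdgeWitness G a b W1 W2) {v x : V} (hva : G.Adj v a) (hb : b ∈ antiNbhd G v)
    (hx : x ∈ antiNbhd G v) : ReachIn G (antiNbhd G v) b x := by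
  by_contra hcon
  obtain ⟨z, hzx, hzv, hza⟩ := hw.exists_far hmin hE hva.symm hx
  obtain ⟨d, hzd, hdb⟩ := hw.exists_reachIn_adj hmin hE hT hva hb.1.symm hzv hza
  have hdz := (hzd.symm ⟨hzv, hza⟩).mono Set.inter_subset_left
  have hbz : ReachIn G (antiNbhd G v) b z := hdz.head hdb.symm (hzd.mem ⟨hzv, hza⟩).1
  rcases hzx with rfl | hzx
  exacts [hcon hbz, hcon (.tail hbz ⟨hzx.symm, hx⟩)]

theorem EdgeWitness.reachIn_of_adj_of_adj
    (hmin : ∀ S : Set V, S ≠ Set.univ → WeaklyFPE (G.induce S)) (hE : EvenHoleFree G)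
    (hT : ∀ (H : Set V) (v : V), ¬ IsTwinWheel G H v) {a b : V} {W1 W2 : Set V}
    (hw : EdgeWitness G a b W1 W2) {v x y : V} (hva : G.Adj v a) (hvb : G.Adj v b)
    (hx : x ∈ antiNbhd G v) (hy : y ∈ antiNbhd G v) : ReachIn G (antiNbhd G v) x y := by
  by_contra hcon
  obtain ⟨C, hC⟩ : ∃ C : Set V, ∀ z, z ∈ C ↔ z ∈ antiNbhd G v ∧ ReachIn G (antiNbhd G v) y z :=
    ⟨{z | z ∈ antiNbhd G v ∧ ReachIn G (antiNbhd G v) y z}, fun _ => Iff.rfl⟩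
  have hCv : ∀ z ∈ C, z ∈ antiNbhd G v := fun z hz => ((hC z).1 hz).1
  have hCadj : ∀ z ∈ C, ∀ t ∈ antiNbhd G v, G.Adj z t → t ∈ C := fun z hz t ht hzt =>
    (hC t).2 ⟨ht, .tail ((hC z).1 hz).2 ⟨hzt, ht⟩⟩
  -- neighbors in `C` of a neighbor `t` of `v` see at most those ends of the edge that `t` sees
  have hsq : ∀ w, G.Adj v w → ∀ t, G.Adj v t → t ∈ antiNbhd G w → ∀ c ∈ C, G.Adj t c →
      c ∈ antiNbhd G w := by
    intro w hvw t hvt htw c hc htc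
    have hcv := hCv c hc
    refine ⟨fun e => hcv.2 (e ▸ hvw), fun hwc => ?_⟩
    exact hE.no_square hvw hwc htc.symm hvt.symm hcv.2 htw.2 hcv.1.symm htw.1.symm
  have hDSa : ∀ c ∈ C, c ∈ antiNbhd G a → ∃ d, ReachIn G (C ∩ antiNbhd G a) c d ∧ G.Adj d b := by
    intro c hc hca
    obtain ⟨d, hd, hdb⟩ := hw.exists_reachIn_adj hmin hE hT hva hvb.ne (hCv c hc) hca
    refine ⟨d, (hd.inter hc fun z hz t ht => hCadj z hz t ht.1).mono ?_, hdb⟩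
    exact fun t ht => ⟨ht.2, ht.1.2⟩
  have hDSb : ∀ c ∈ C, c ∈ antiNbhd G b → ∃ d, ReachIn G (C ∩ antiNbhd G b) c d ∧ G.Adj d a := by
    intro c hc hcb
    obtain ⟨d, hd, hda⟩ := hw.swap.exists_reachIn_adj hmin hE hT hvb hva.ne (hCv c hc) hcb
    refine ⟨d, (hd.inter hc fun z hz t ht => hCadj z hz t ht.1).mono ?_, hda⟩
    exact fun t ht => ⟨ht.2, ht.1.2⟩
  obtain ⟨T, hTdef⟩ : ∃ T : Set V, ∀ z, z ∈ T ↔ z ∈ C ∨ G.Adj v z ∧ ∃ c ∈ C, G.Adj z c :=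
    ⟨{z | z ∈ C ∨ G.Adj v z ∧ ∃ c ∈ C, G.Adj z c}, fun _ => Iff.rfl⟩
  have hTC : ∀ z ∈ antiNbhd G a \ T, ∀ c ∈ C, z ≠ c ∧ ¬ G.Adj z c := by
    rintro z ⟨hza, hzT⟩ c hc
    rw [hTdef] at hzT
    push Not at hzT
    refine ⟨fun e => hzT.1 (e ▸ hc), fun hzc => ?_⟩
    by_cases hzv : z ∈ antiNbhd G v
    · exact hzT.1 (hCadj c hc z hzv hzc.symm)
    · rcases not_mem_antiNbhd.1 hzv with rfl | h
      · exact hza.2 hva.symm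
      · exact hzT.2 h c hc hzc
  -- the neighbor `u` of the component `C`
  obtain ⟨s, f, u, hvu, ⟨c, hc, huc⟩, hua, hf, f0, fs, hfS⟩ :
      ∃ s f u, G.Adj v u ∧ (∃ c ∈ C, G.Adj u c) ∧ u ∈ antiNbhd G a ∧
        IndPath G s f ∧ f 0 = b ∧ f s = u ∧ ∀ i, 0 < i → i < s → f i ∈ antiNbhd G a \ T := by
    obtain ⟨z, hzx, hzv, hza⟩ := hw.exists_far hmin hE hva.symm hx
    obtain ⟨t, hty, htv, hta⟩ := hw.exists_far hmin hE hva.symm hy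
    have htC : t ∈ C := by
      refine (hC t).2 ⟨htv, ?_⟩
      rcases hty with rfl | h
      exacts [.refl, .single ⟨h, htv⟩]
    have hxz : ReachIn G (antiNbhd G v) x z := by
      rcases hzx with rfl | h
      exacts [.refl, .single ⟨h, hzv⟩]
    obtain ⟨d, hzd, hdb⟩ := hw.exists_reachIn_adj hmin hE hT hva hvb.ne hzv hza
    obtain ⟨hdv, hda⟩ := hzd.mem ⟨hzv, hza⟩
    have hdT : d ∉ T := by
      rw [hTdef]
      rintro (h | h)
      · have h1 : ReachIn G (antiNbhd G v) x d :=
          hxz.trans (hzd.mono Set.inter_subset_left)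
        exact hcon (h1.trans (((hC d).1 h).2.symm hy))
      · exact hdv.2 h.1
    obtain ⟨z', u, hdz', hz'u, hua, huT, hz'T⟩ :=
      (hw.reachIn_antiNbhd hmin hE hda hta).exists_first hdT ((hTdef t).2 (Or.inl htC))
    have hz'a := hdz'.mono Set.sdiff_subset |>.mem hda
    obtain ⟨s, f, hf, f0, fs, hfS⟩ := ReachIn.exists_indPath
      (hdz'.head hdb.symm ⟨hda, hdT⟩) hz'u
    have hu : G.Adj v u ∧ ∃ c ∈ C, G.Adj u c := by
      refine ((hTdef u).1 huT).resolve_left fun huC => ?_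
      exact (hTC z' ⟨hz'a, hz'T⟩ u huC).2 hz'u
    exact ⟨s, f, u, hu.1, hu.2, hua, hf, f0, fs, hfS⟩
  have hca := hsq a hva u hvu hua c hc huc
  have hub : u ∈ antiNbhd G b := by
    refine ⟨fun e => hua.2 (e ▸ hw.adj), fun hbu => ?_⟩
    have hfar : ∀ c ∈ C, G.Adj u c → c ∉ antiNbhd G b := by
      intro c hc huc hcb
      obtain ⟨e, hce, hea⟩ := hDSb c hc hcb
      obtain ⟨n, q, hq, q0, qn, hqS⟩ := ReachIn.exists_indPath
        (hce.head huc ⟨hc, hcb⟩) hea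
      obtain ⟨H, hH⟩ := isTwinWheel_of_common_ends hq
        (hq.two_le (by rw [q0, qn]; exact ⟨hua.1.symm, fun h => hua.2 h.symm⟩))
        (v := v) (y := b) (by rwa [q0]) (by rwa [qn])
        (fun i hi hi' => hCv _ (hqS i hi hi').1) hvb.symm (by rwa [q0])
        (by rw [qn]; exact hw.adj.symm) (fun i hi hi' => (hqS i hi hi').2)
      exact hT _ _ hH
    have hbc : G.Adj b c := (not_mem_antiNbhd.1 (hfar c hc huc)).resolve_left fun e =>
      (hCv c hc).2 (e ▸ hvb)
    obtain ⟨t, htb, hct⟩ := hw.swap.domination hmin hbc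
    have htC : t ∈ C := by
      refine hCadj c hc t ?_ hct
      by_contra htv
      rcases not_mem_antiNbhd.1 htv with rfl | htv
      · exact htb.2 hvb.symm
      · exact hE.no_square hvb hbc hct htv.symm (hCv c hc).2 htb.2 (hCv c hc).1.symm htb.1.symm
    obtain ⟨e, hte, hea⟩ := hDSb t htC htb
    obtain ⟨n, q, hq, q0, qn, hqS⟩ := ReachIn.exists_indPath
      (hte.head hct ⟨htC, htb⟩) hea
    have hn := hq.two_le (by rw [q0, qn]; exact ⟨hca.1.symm, fun h => hca.2 h.symm⟩)
    have h1 := hE.odd_of_apex hq hn (v := b) (by rwa [q0]) (by rw [qn]; exact hw.adj.symm)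
      (fun i hi hi' => (hqS i hi hi').2)
    obtain ⟨g, hg, g0, g1, g2⟩ := indPath_two hvu.symm hva hua.1 fun h => hua.2 h.symm
    have hcv := hCv c hc
    have h2 := hE.odd_paths (hg.cons (z := c) (by rw [g0]; exact huc.symm) (by
        intro i hi hi'
        interval_cases i
        · rw [g1]; exact ⟨hcv.1, fun h => hcv.2 h.symm⟩
        · rw [g2]; exact ⟨hca.1, fun h => hca.2 h.symm⟩)) hq (by simp [q0]) (by simp [qn, g2])
      (by omega) hn (by
        intro i hi hi' j hj hj'
        have hqj := hqS j hj hj'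
        rw [if_neg (by omega)]
        obtain rfl | rfl : i = 1 ∨ i = 2 := by omega
        · rw [show 1 - 1 = 0 by rfl, g0]
          exact ⟨fun e => (hCv _ hqj.1).2 (e ▸ hvu), fun h => hfar _ hqj.1 h hqj.2⟩
        · rw [show 2 - 1 = 1 by rfl, g1]
          exact ⟨(hCv _ hqj.1).1.symm, (hCv _ hqj.1).2⟩)
    rw [Nat.odd_add'] at h2
    exact absurd (h2.1 h1) (by decide)
  have hcb := hsq b hvb u hvu hub c hc huc
  obtain ⟨e, hce, heb⟩ := hDSa c hc hca
  obtain ⟨e', hce', hea'⟩ := hDSb c hc hcb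
  obtain ⟨n, p, hp, p0, pn, hpS⟩ := ReachIn.exists_indPath
    (hce.head huc ⟨hc, hca⟩) heb
  obtain ⟨m, q, hq, q0, qm, hqS⟩ := ReachIn.exists_indPath
    (hce'.head huc ⟨hc, hcb⟩) hea'
  have hs := hf.two_le (by rwa [f0, fs])
  have hn := hp.two_le (by rw [p0, pn]; exact ⟨hub.1.symm, fun h => hub.2 h.symm⟩)
  have hm := hq.two_le (by rw [q0, qm]; exact ⟨hua.1.symm, fun h => hua.2 h.symm⟩)
  have h1 := hE.odd_of_apex hp hn (v := v) (by rwa [p0]) (by rwa [pn])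
    (fun i hi hi' => hCv _ (hpS i hi hi').1)
  have h2 := hE.odd_of_apex hq hm (v := v) (by rwa [q0]) (by rwa [qm])
    (fun i hi hi' => hCv _ (hqS i hi hi').1)
  have h3 := hE.odd_paths hf hp.reverse (by simp [f0, pn]) (by simp [fs, p0]) hs hn
    (fun i hi hi' j hj hj' => hTC _ (hfS i hi hi') _ (hpS _ (by omega) (by omega)).1)
  have h4 := hE.odd_paths hf (hq.reverse.cons (z := b) (by simpa [qm] using hw.adj.symm) (by
      intro i hi hi'
      have : q (m - i) ∈ antiNbhd G b := by
        rcases hi'.lt_or_eq with h | rfl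
        · exact (hqS _ (by omega) (by omega)).2
        · rwa [Nat.sub_self, q0]
      exact ⟨this.1.symm, this.2⟩)) (by simp [f0]) (by simp [fs, q0]) hs (by omega) (by
    intro i hi hi' j hj hj'
    have hfi := hfS i hi hi'
    rw [if_neg (by omega)]
    obtain rfl | hj1 : j = 1 ∨ 1 < j := by omega
    · rw [show m - (1 - 1) = m by omega, qm]
      exact ⟨hfi.1.1, fun h => hfi.1.2 h.symm⟩
    · exact hTC _ hfi _ (hqS _ (by omega) (by omega)).1)
  rw [Nat.odd_add] at h3 h4
  rw [Nat.even_add_one] at h4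
  rw [← Nat.not_even_iff_odd] at h1 h2
  have := mt h3.1
  tauto

/-- The complement of every closed neighborhood is connected. -/
theorem EdgeWitness.reachIn_antiNbhd_all
    (hmin : ∀ S : Set V, S ≠ Set.univ → WeaklyFPE (G.induce S)) (hE : EvenHoleFree G)
    (hT : ∀ (H : Set V) (v : V), ¬ IsTwinWheel G H v) {a b : V} {W1 W2 : Set V}
    (hw : EdgeWitness G a b W1 W2) {v x y : V}
    (hx : x ∈ antiNbhd G v) (hy : y ∈ antiNbhd G v) : ReachIn G (antiNbhd G v) x y := by
  by_cases hva : v = a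
  · subst hva; exact hw.reachIn_antiNbhd hmin hE hx hy
  by_cases hvb : v = b
  · subst hvb; exact hw.swap.reachIn_antiNbhd hmin hE hx hy
  by_cases ha : a ∈ antiNbhd G v <;> by_cases hb : b ∈ antiNbhd G v
  · have hv : v ∉ ClosedNbhd G {a, b} :=
      not_mem_closedNbhd_pair.2 ⟨⟨hva, fun h => ha.2 h.symm⟩, hvb, fun h => hb.2 h.symm⟩
    have h := fun z hz => hw.reachIn_of_not_mem_closedNbhd (x := z) hmin hv hz
    exact ((h x hx).symm ha).trans (h y hy)
  · have hvb' := (not_mem_antiNbhd.1 hb).resolve_left (Ne.symm hvb)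
    have h := fun z hz => hw.swap.reachIn_of_adj_of_not_adj (x := z) hmin hE hT hvb' ha hz
    exact ((h x hx).symm ha).trans (h y hy)
  · have hva' := (not_mem_antiNbhd.1 ha).resolve_left (Ne.symm hva)
    have h := fun z hz => hw.reachIn_of_adj_of_not_adj (x := z) hmin hE hT hva' hb hz
    exact ((h x hx).symm hb).trans (h y hy)
  · exact hw.reachIn_of_adj_of_adj hmin hE hT
      ((not_mem_antiNbhd.1 ha).resolve_left (Ne.symm hva))
      ((not_mem_antiNbhd.1 hb).resolve_left (Ne.symm hvb)) hx hy

theorem ReachIn.reachable_induce {S : Set V} {x y : V} (h : ReachIn G S x y) (hx : x ∈ S)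
    (hy : y ∈ S) : (G.induce S).Reachable ⟨x, hx⟩ ⟨y, hy⟩ := by
  induction h with
  | refl => exact .refl _
  | @tail z t h1 h2 ih =>
    have hz := ReachIn.mem h1 hx
    exact (ih hz).trans (SimpleGraph.Adj.reachable (G := G.induce S) (u := ⟨z, hz⟩) h2.1)

theorem WeakWitness.edgeWitness {a b : V} {W1 W2 : Set V} (h : WeakWitness G [a, b] W1 W2) :
    EdgeWitness G a b W1 W2 := by
  obtain ⟨hl, -, h1, h2, hI, hU, hne⟩ := h
  rw [setOf_mem_pair] at hI hU hne
  exact ⟨by simpa using hl.2.2 0 1 (by simp) (by simp), h1, h2, hI, hU, hne⟩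

end StarCutset

/-- A minimal non-weakly FPE graph with no even hole and no twin wheel, having a witness
path of length one, admits no full star cutset. -/
theorem stmt18 {V : Type u} [Finite V] (G : SimpleGraph V)
    (hEH : EvenHoleFree G)
    (hTW : ∀ (H : Set V) (v : V), ¬ IsTwinWheel G H v)
    (hG : MinNonWeaklyFPE G)
    (v0 w0 : V) (W1 W2 : Set V) (hw : WeakWitness G [v0, w0] W1 W2) :
    ¬ HasFullStarCutset G := by
  rintro ⟨-, v, hv⟩
  have hw' := hw.edgeWitness
  have e : (insert v {u | G.Adj v u} : Set V)ᶜ = antiNbhd G v := by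
    ext z
    simp [antiNbhd]
  rw [e] at hv
  obtain ⟨z, hz⟩ := hw'.antiNbhd_nonempty hG.2 v
  have : Nonempty (antiNbhd G v) := ⟨⟨z, hz⟩⟩
  exact hv ⟨fun x y => (hw'.reachIn_antiNbhd_all hG.2 hEH hTW x.2 y.2).reachable_induce x.2 y.2⟩
end
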